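/- Let d ≥ 3 and N ≥ 3, and let α be an N×N skew-symmetric matrix with entries in {−1,0,1} and no zero row. Assume that for every prime p the Main Conjecture holds over the algebraic closure of F_p for every irreducible skew-symmetric matrix with entries in {−1,0,1} of size at most N. Let Q = {z ∈ ℝ^{Nd} : ω_j(z) = 0 for all 1 ≤ j ≤ N}, let L ≥ 2 and R ≥ 1, and let w: ℝ^{Nd} → ℝ be a bounded function with supp(w) ⊂ B_R^{Nd} = {|z|_∞ < R}. Then | Σ_{z ∈ Q ∩ 𝒵_L} w(z) | ≤ C(N,d) R^{⌊N/2⌋ N₂(d) + (N−2)(d−1)} L^{N(d−1)} ‖w‖_∞, where 𝒵_L is the set of z ∈ ℤ_L^{Nd} whose components z₁,…,z_N ∈ ℝ^d are all nonzero, N₂(d) = 4d(4d² + 2d − 1) + 6d + 4, and C(N,d) depends only on N and d. -/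

import Mathlib

open MvPolynomial

/-- `N₂(d) = 4d(4d² + 2d − 1) + 6d + 4`. -/
def N2 (d : ℕ) : ℕ := 4 * d * (4 * d ^ 2 + 2 * d - 1) + 6 * d + 4

/-- The quadratic polynomial `q_j` (paper index `j+2`, `j : Fin (N-2)`) over a commutative
ring `K`, for an integer matrix `α` (whose entries are cast into `K`) and a fixed pair
`(z₁, v)`; the variables `(z₂,…,z_{N-1})` are indexed by `Fin (N-2) × Fin d`. -/
noncomputable def qPolyInt (N d : ℕ) (K : Type*) [CommRing K]
    (α : Matrix (Fin N) (Fin N) ℤ) (z1 v : Fin d → K) (j : Fin (N - 2)) :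
    MvPolynomial (Fin (N - 2) × Fin d) K :=
  ∑ k : Fin d,
    X (j, k) *
      (C ((α ⟨j.1 + 1, by have := j.2; omega⟩ ⟨0, by have := j.2; omega⟩ : ℤ) * z1 k +
            (α ⟨j.1 + 1, by have := j.2; omega⟩ ⟨N - 1, by have := j.2; omega⟩ : ℤ) * v k) +
        ∑ i : Fin (N - 2),
          C (((α ⟨j.1 + 1, by have := j.2; omega⟩ ⟨i.1 + 1, by have := i.2; omega⟩ -
                  α ⟨j.1 + 1, by have := j.2; omega⟩ ⟨N - 1, by have := j.2; omega⟩ *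
                    α ⟨0, by have := j.2; omega⟩ ⟨i.1 + 1, by have := i.2; omega⟩ : ℤ) : K)) *
            X (i, k))

/-- An `N × N` matrix is irreducible: there is no partition of the index set into two
nonempty sets `I`, `J` with `α i j = 0` for all `i ∈ I`, `j ∈ J`. -/
def MatIrreducible {N : ℕ} (α : Matrix (Fin N) (Fin N) ℤ) : Prop :=
  ∀ I : Set (Fin N), I.Nonempty → Iᶜ.Nonempty → ∃ i ∈ I, ∃ j ∈ Iᶜ, α i j ≠ 0

/-- The Main Conjecture for the (normalized, `α_{1N} = 1`) integer matrix `α` over the field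
`K`: for every `(z₁,v) ∈ Q₁ ∩ A₂` the affine algebraic set `Q(z₁,v) ⊆ K^{(N-2)d}` has Krull
dimension `(N-2)(d-1)` (the Krull dimension of an affine algebraic set being that of its
coordinate ring). -/
def MainConj (N d : ℕ) (K : Type*) [Field K] (α : Matrix (Fin N) (Fin N) ℤ) : Prop :=
  ∀ z1 v : Fin d → K, (∑ k : Fin d, z1 k * v k) = 0 → z1 ≠ 0 → v ≠ 0 →
    ringKrullDim (MvPolynomial (Fin (N - 2) × Fin d) K ⧸
        MvPolynomial.vanishingIdeal K
          {w | ∀ j, MvPolynomial.eval w (qPolyInt N d K α z1 v j) = 0}) =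
      (((N - 2) * (d - 1) : ℕ) : WithBot ℕ∞)


theorem height_point {K : Type*} [Field K] [IsAlgClosed K] {σ : Type*} [Fintype σ]
    (x : σ → K) :
    (Fintype.card σ : WithBot ℕ∞) ≤ ((vanishingIdeal K {x} : Ideal (MvPolynomial σ K)).height : WithBot ℕ∞) := by
  have hdim : ringKrullDim (MvPolynomial σ K) = (Fintype.card σ : WithBot ℕ∞) := by
    rw [MvPolynomial.ringKrullDim_of_isNoetherianRing, ringKrullDim_eq_zero_of_field]
    simp
  rw [← hdim]
  rw [ringKrullDim_le_iff_isMaximal_height_le]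
  intro m hm
  obtain ⟨y, rfl⟩ := (isMaximal_iff_eq_vanishingIdeal_singleton).1 hm
  let f : MvPolynomial σ K →ₐ[K] MvPolynomial σ K := aeval (fun i => X i + C (y i - x i))
  let g : MvPolynomial σ K →ₐ[K] MvPolynomial σ K := aeval (fun i => X i - C (y i - x i))
  let e : MvPolynomial σ K ≃ₐ[K] MvPolynomial σ K := AlgEquiv.ofAlgHom f g
    (by ext i : 1; simp [f, g, algHom_C]) (by ext i : 1; simp [f, g, algHom_C])
  have : (vanishingIdeal K {y} : Ideal (MvPolynomial σ K)) =
      (vanishingIdeal K {x} : Ideal (MvPolynomial σ K)).comap e.toRingEquiv := by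
    ext p
    have : aeval x (f p) = aeval y p := by
      have : (aeval x).comp f = aeval (R := K) y := by
        ext i; simp [f]
      rw [← this]; rfl
    rw [Ideal.mem_comap, mem_vanishingIdeal_singleton_iff, mem_vanishingIdeal_singleton_iff, ← this]
    rfl
  rw [this, RingEquiv.height_comap]

theorem dim_ge {K : Type*} [Field K] [IsAlgClosed K] {σ : Type*} [Fintype σ]
    (s : Finset (MvPolynomial σ K)) (P : Ideal (MvPolynomial σ K))
    (hP : P ∈ (Ideal.span (s : Set (MvPolynomial σ K))).minimalPrimes) :
    (Fintype.card σ : WithBot ℕ∞) ≤ ringKrullDim (MvPolynomial σ K ⧸ P) + s.card := by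
  classical
  set I := Ideal.span (s : Set (MvPolynomial σ K)) with hI
  have hPp : P.IsPrime := hP.1.1
  have hfin : I.minimalPrimes.Finite := Ideal.finite_minimalPrimes_of_isNoetherianRing _ I
  -- find g
  have hg : ∃ g, g ∉ P ∧ ∀ Q ∈ I.minimalPrimes, Q ≠ P → g ∈ Q := by
    let F := hfin.toFinset.erase P
    have : ∀ Q ∈ F, ∃ g, g ∈ Q ∧ g ∉ P := by
      intro Q hQ
      simp only [F, Finset.mem_erase, Set.Finite.mem_toFinset] at hQ
      by_contra! h
      exact hQ.1 (le_antisymm h (hP.2 hQ.2.1 h))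
    choose! g hg using this
    refine ⟨∏ Q ∈ F, g Q, ?_, ?_⟩
    · intro h
      obtain ⟨Q, hQ, h'⟩ := (Ideal.IsPrime.prod_mem_iff).1 h
      exact (hg Q hQ).2 h'
    · intro Q hQ hne
      have hQF : Q ∈ F := by simp [F, hQ, hne]
      exact Ideal.mem_of_dvd _ (Finset.dvd_prod_of_mem g hQF) (hg Q hQF).1
  obtain ⟨g, hgP, hg⟩ := hg
  -- find point
  have hx : ∃ x : σ → K, x ∈ zeroLocus K P ∧ aeval x g ≠ 0 := by
    by_contra! h
    apply hgP
    have : g ∈ vanishingIdeal K (zeroLocus K P) := h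
    rwa [IsPrime.vanishingIdeal_zeroLocus] at this
  obtain ⟨x, hxP, hxg⟩ := hx
  set m : Ideal (MvPolynomial σ K) := vanishingIdeal K {x}
  have hPm : P ≤ m := fun p hp => (mem_vanishingIdeal_singleton_iff x p).2 (hxP p hp)
  have hgm : g ∉ m := fun h => hxg ((mem_vanishingIdeal_singleton_iff x g).1 h)
  have hIm : I ≤ m := hP.1.2.trans hPm
  have h1 := height_point (K := K) x
  refine h1.trans ?_
  have h2 : m.height ≤ (m.map (Ideal.Quotient.mk I)).height + I.spanFinrank :=
    Ideal.height_le_height_add_spanFinrank_of_le hIm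
  have h3 : I.spanFinrank ≤ s.card := by
    have := Submodule.spanFinrank_span_le_ncard_of_finite (R := MvPolynomial σ K) (s.finite_toSet)
    rwa [Set.ncard_coe_finset] at this
  have hmp : (m.map (Ideal.Quotient.mk I)).IsPrime := Ideal.isPrime_map_quotientMk_of_isPrime hIm
  have h4 : ((m.map (Ideal.Quotient.mk I)).height : WithBot ℕ∞) ≤ ringKrullDim (MvPolynomial σ K ⧸ P) := by
    rw [ringKrullDim_quotient]
    have e1 := PrimeSpectrum.height_eq_orderHeight (⟨_, hmp⟩ : PrimeSpectrum (MvPolynomial σ K ⧸ I))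
    simp only at e1
    rw [e1, Order.height_eq_iSup_last_eq]
    have key : ∀ Q : PrimeSpectrum (MvPolynomial σ K ⧸ I), Q.asIdeal ≤ m.map (Ideal.Quotient.mk I) →
        P ≤ Q.asIdeal.comap (Ideal.Quotient.mk I) := by
      intro Q hQ
      have hQp := Q.2
      have hle : I ≤ Q.asIdeal.comap (Ideal.Quotient.mk I) := by
        intro p hp
        rw [Ideal.mem_comap, Ideal.Quotient.eq_zero_iff_mem.2 hp]
        exact Ideal.zero_mem _
      obtain ⟨P', hP', hle'⟩ := Ideal.exists_minimalPrimes_le hle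
      by_cases hPP : P' = P
      · rwa [← hPP]
      · exfalso
        apply hgm
        have := hle' (hg P' hP' hPP)
        have h5 : Ideal.Quotient.mk I g ∈ m.map (Ideal.Quotient.mk I) := hQ this
        have h6 : g ∈ (m.map (Ideal.Quotient.mk I)).comap (Ideal.Quotient.mk I) := h5
        rwa [Ideal.comap_map_of_surjective _ Ideal.Quotient.mk_surjective, ← RingHom.ker_eq_comap_bot,
          Ideal.mk_ker, sup_of_le_left hIm] at h6
    have hne : Nonempty (PrimeSpectrum.zeroLocus (P : Set (MvPolynomial σ K))) :=
      ⟨⟨⟨P, hPp⟩, (PrimeSpectrum.mem_zeroLocus _ _).2 (fun _ h => h)⟩⟩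
    rw [Order.krullDim_eq_iSup_length]
    rw [WithBot.coe_le_coe]
    refine iSup_le fun l => iSup_le fun hl => ?_
    have hl2 : ∀ i, P ≤ (l i).asIdeal.comap (Ideal.Quotient.mk I) := fun i => key _ (by
      have : l i ≤ l.last := l.monotone (Fin.le_last i)
      rw [hl] at this
      exact this)
    let l' : LTSeries (PrimeSpectrum.zeroLocus (P : Set (MvPolynomial σ K))) :=
      { length := l.length
        toFun := fun i => ⟨PrimeSpectrum.comap (Ideal.Quotient.mk I) (l i), hl2 i⟩
        step := by
          intro i
          have : l i.castSucc < l i.succ := l.step i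
          have h7 : (l i.castSucc).asIdeal < (l i.succ).asIdeal := this
          show (l i.castSucc).asIdeal.comap (Ideal.Quotient.mk I) < (l i.succ).asIdeal.comap (Ideal.Quotient.mk I)
          rw [lt_iff_le_not_ge] at h7 ⊢
          rw [Ideal.comap_le_comap_iff_of_surjective _ Ideal.Quotient.mk_surjective,
            Ideal.comap_le_comap_iff_of_surjective _ Ideal.Quotient.mk_surjective]
          exact h7 }
    exact le_iSup (fun p : LTSeries (PrimeSpectrum.zeroLocus (P : Set (MvPolynomial σ K))) => (p.length : ℕ∞)) l'
  calc (m.height : WithBot ℕ∞) ≤ ((m.map (Ideal.Quotient.mk I)).height : WithBot ℕ∞) + (I.spanFinrank : ℕ∞) := by exact_mod_cast h2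
    _ ≤ _ := add_le_add h4 (by exact_mod_cast h3)


noncomputable def HilbF {K : Type*} [Field K] {σ : Type*} (J : Ideal (MvPolynomial σ K)) (t : ℕ) : ℕ :=
  Module.finrank K ((restrictTotalDegree σ K t).map (Ideal.Quotient.mkₐ K J).toLinearMap)

theorem HilbF_base {K : Type*} [Field K] {σ : Type*} [Fintype σ] (J : Ideal (MvPolynomial σ K)) (t : ℕ) :
    HilbF J t ≤ (t + 1) ^ Fintype.card σ := by
  classical
  refine (Submodule.finrank_map_le _ _).trans ?_
  let F : Finset (MvPolynomial σ K) := (Finset.univ : Finset (σ → Fin (t+1))).image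
    (fun a => monomial (Finsupp.equivFunOnFinite.symm (fun i => (a i : ℕ))) (1 : K))
  have hle : restrictTotalDegree σ K t ≤ Submodule.span K (F : Set (MvPolynomial σ K)) := by
    intro p hp
    rw [mem_restrictTotalDegree] at hp
    rw [p.as_sum]
    refine Submodule.sum_mem _ fun v hv => ?_
    have : monomial v (coeff v p) = (coeff v p) • (monomial v (1 : K)) := by
      rw [smul_monomial]; simp
    rw [this]
    refine Submodule.smul_mem _ _ (Submodule.subset_span ?_)
    have hvd := (le_totalDegree hv).trans hp
    have hvi : ∀ i, v i < t + 1 := by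
      intro i
      have : v i ≤ v.sum fun _ e => e := by
        rw [Finsupp.sum_fintype _ _ (by simp)]
        exact Finset.single_le_sum (f := fun i => v i) (by simp) (Finset.mem_univ i)
      omega
    simp only [F, Finset.coe_image, Finset.coe_univ, Set.image_univ, Set.mem_range]
    refine ⟨fun i => ⟨v i, hvi i⟩, ?_⟩
    congr 2
    ext i
    simp
  calc Module.finrank K (restrictTotalDegree σ K t)
      ≤ Module.finrank K (Submodule.span K (F : Set (MvPolynomial σ K))) :=
        Submodule.finrank_mono hle
    _ ≤ F.card := finrank_span_finset_le_card F
    _ ≤ _ := by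
      refine Finset.card_image_le.trans ?_
      simp

theorem HilbF_mono {K : Type*} [Field K] {σ : Type*} [Fintype σ] (J : Ideal (MvPolynomial σ K)) {t u : ℕ}
    (h : t ≤ u) : HilbF J t ≤ HilbF J u := by
  refine Submodule.finrank_mono (Submodule.map_mono ?_)
  intro p hp
  rw [mem_restrictTotalDegree] at *
  omega

theorem HilbF_step {K : Type*} [Field K] {σ : Type*} [Fintype σ] (J J' : Ideal (MvPolynomial σ K))
    (f : MvPolynomial σ K) (hf : f.totalDegree ≤ 2) (hreg : ∀ g, f * g ∈ J → g ∈ J)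
    (hJ : J ≤ J') (hfJ : f ∈ J') (t : ℕ) :
    HilbF J' (t + 2) + HilbF J t ≤ HilbF J (t + 2) := by
  set A := (restrictTotalDegree σ K (t+2)).map (Ideal.Quotient.mkₐ K J).toLinearMap with hA
  set B := (restrictTotalDegree σ K t).map (Ideal.Quotient.mkₐ K J).toLinearMap with hB
  let π : (MvPolynomial σ K ⧸ J) →ₗ[K] (MvPolynomial σ K ⧸ J') := (Ideal.Quotient.factorₐ K hJ).toLinearMap
  have h1 := LinearMap.finrank_range_add_finrank_ker (π.domRestrict A)
  have h2 : LinearMap.range (π.domRestrict A) =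
      (restrictTotalDegree σ K (t+2)).map (Ideal.Quotient.mkₐ K J').toLinearMap := by
    rw [LinearMap.range_domRestrict, hA, ← Submodule.map_comp]
    rfl
  have h3 : HilbF J t ≤ Module.finrank K (LinearMap.ker (π.domRestrict A)) := by
    let μ : (MvPolynomial σ K ⧸ J) →ₗ[K] (MvPolynomial σ K ⧸ J) := LinearMap.mulLeft K (Ideal.Quotient.mk J f)
    have hμ : Function.Injective μ := by
      rw [← LinearMap.ker_eq_bot, LinearMap.ker_eq_bot']
      intro x hx
      obtain ⟨g, rfl⟩ := Ideal.Quotient.mk_surjective x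
      have : Ideal.Quotient.mk J (f * g) = 0 := by simpa [μ] using hx
      rw [Ideal.Quotient.eq_zero_iff_mem] at this ⊢
      exact hreg g this
    have h4 : Module.finrank K (B.map μ) = HilbF J t := (Submodule.equivMapOfInjective μ hμ B).finrank_eq.symm
    have h5 : B.map μ ≤ (LinearMap.ker (π.domRestrict A)).map A.subtype := by
      rintro _ ⟨_, ⟨g, hg, rfl⟩, rfl⟩
      have hg' : g.totalDegree ≤ t := (mem_restrictTotalDegree _ _ _).1 hg
      have hm : μ ((Ideal.Quotient.mkₐ K J).toLinearMap g) = (Ideal.Quotient.mkₐ K J).toLinearMap (f * g) := by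
        simp [μ]
      have hmem : (Ideal.Quotient.mkₐ K J).toLinearMap (f * g) ∈ A := by
        refine ⟨f * g, ?_, rfl⟩
        refine (mem_restrictTotalDegree _ _ _).2 ((totalDegree_mul _ _).trans (by omega))
      refine ⟨⟨_, hmem⟩, ?_, hm.symm⟩
      rw [SetLike.mem_coe, LinearMap.mem_ker]
      show Ideal.Quotient.mk J' (f * g) = 0
      rw [Ideal.Quotient.eq_zero_iff_mem]
      exact Ideal.mul_mem_right _ _ hfJ
    rw [← h4]
    refine (Submodule.finrank_mono h5).trans ?_
    exact Submodule.finrank_map_le _ _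
  rw [h2] at h1
  have h6 : HilbF J (t+2) = Module.finrank K A := rfl
  rw [h6, ← h1]
  exact Nat.add_le_add_left h3 _

theorem HilbF_mul {K : Type*} [Field K] {σ : Type*} [Fintype σ] (J J' : Ideal (MvPolynomial σ K))
    (f : MvPolynomial σ K) (hf : f.totalDegree ≤ 2) (hreg : ∀ g, f * g ∈ J → g ∈ J)
    (hJ : J ≤ J') (hfJ : f ∈ J') (t k : ℕ) :
    k * HilbF J' t ≤ HilbF J (t + 2 * k) := by
  induction k with
  | zero => simp
  | succ k ih =>
    have h1 := HilbF_step J J' f hf hreg hJ hfJ (t + 2 * k)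
    have h2 : HilbF J' t ≤ HilbF J' (t + 2 * k + 2) := HilbF_mono J' (by omega)
    have e : t + 2 * (k + 1) = t + 2 * k + 2 := by ring
    rw [e, add_mul]
    omega

theorem HilbF_interp {K : Type*} [Field K] {σ : Type*} [Fintype σ] (J : Ideal (MvPolynomial σ K))
    (A : Finset K) (s : ℕ) (hA : A.card ≤ s + 1) (Y : Finset (σ → K)) (hYA : ∀ y ∈ Y, ∀ i, y i ∈ A)
    (hYJ : ∀ y ∈ Y, ∀ f ∈ J, eval y f = 0) :
    Y.card ≤ HilbF J (Fintype.card σ * s) := by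
  classical
  let P : (σ → K) → MvPolynomial σ K := fun x => ∏ i, ∏ a ∈ A.erase (x i), (X i - C a)
  have hPdeg : ∀ x ∈ Y, (P x).totalDegree ≤ Fintype.card σ * s := by
    intro x hx
    refine (totalDegree_finsetProd _ _).trans ?_
    have : ∀ i ∈ (Finset.univ : Finset σ), (∏ a ∈ A.erase (x i), (X i - C a : MvPolynomial σ K)).totalDegree ≤ s := by
      intro i _
      refine (totalDegree_finsetProd _ _).trans ?_
      refine (Finset.sum_le_card_nsmul _ _ 1 ?_).trans ?_
      · intro a _
        refine (totalDegree_sub _ _).trans ?_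
        simp
      · rw [Finset.card_erase_of_mem (hYA x hx i)]
        simp; omega
    refine (Finset.sum_le_card_nsmul _ _ s this).trans ?_
    simp
  have hPself : ∀ x, eval x (P x) ≠ 0 := by
    intro x
    simp only [P, map_prod, map_sub, eval_X, eval_C]
    refine Finset.prod_ne_zero_iff.2 fun i _ => Finset.prod_ne_zero_iff.2 fun a ha => ?_
    have := Finset.ne_of_mem_erase ha
    exact sub_ne_zero.2 this.symm
  have hPother : ∀ x ∈ Y, ∀ y ∈ Y, x ≠ y → eval y (P x) = 0 := by
    intro x hx y hy hxy
    obtain ⟨i, hi⟩ := Function.ne_iff.1 hxy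
    simp only [P, map_prod, map_sub, eval_X, eval_C]
    refine Finset.prod_eq_zero (Finset.mem_univ i) ?_
    refine Finset.prod_eq_zero (i := y i) (Finset.mem_erase.2 ⟨fun h => hi h.symm, hYA y hy i⟩) (sub_self _)
  let b : Y → ((restrictTotalDegree σ K (Fintype.card σ * s)).map (Ideal.Quotient.mkₐ K J).toLinearMap) :=
    fun x => ⟨(Ideal.Quotient.mkₐ K J).toLinearMap (P x), ⟨P x, (mem_restrictTotalDegree _ _ _).2 (hPdeg x x.2), rfl⟩⟩
  have hb : LinearIndependent K b := by
    rw [Fintype.linearIndependent_iff]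
    intro c hc y
    have h1 : (Ideal.Quotient.mkₐ K J).toLinearMap (∑ x : Y, c x • P x) = 0 := by
      have := congrArg Subtype.val hc
      simpa [b] using this
    have h2 : (∑ x : Y, c x • P x) ∈ J := Ideal.Quotient.eq_zero_iff_mem.1 h1
    have h3 := hYJ y y.2 _ h2
    rw [map_sum, Finset.sum_eq_single y] at h3
    · rw [smul_eval] at h3
      exact (mul_eq_zero.1 h3).resolve_right (hPself _)
    · intro x _ hxy
      rw [smul_eval, hPother x x.2 y y.2 (fun h => hxy (Subtype.ext h)), mul_zero]
    · simp
  have := hb.fintype_card_le_finrank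
  rw [Fintype.card_coe] at this
  exact this

theorem hilb_chain {K : Type*} [Field K] [IsAlgClosed K] {σ ι : Type*} [Fintype σ]
    (q : ι → MvPolynomial σ K) (hq : ∀ j, (q j).totalDegree ≤ 2) (D r : ℕ)
    (hDr : D + r = Fintype.card σ)
    (hdim : ∀ P : Ideal (MvPolynomial σ K), P.IsPrime → (∀ j, q j ∈ P) →
      ringKrullDim (MvPolynomial σ K ⧸ P) ≤ (D : WithBot ℕ∞)) :
    ∀ j ≤ r, ∃ s : Finset (MvPolynomial σ K), s.card ≤ j ∧
      (∀ f ∈ s, f ∈ Submodule.span K (Set.range q)) ∧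
      ∀ t, HilbF (Ideal.span (s : Set (MvPolynomial σ K))).radical t ≤
        3 ^ (Fintype.card σ * j) * (t + 1) ^ (Fintype.card σ - j) := by
  classical
  intro j
  induction j with
  | zero =>
    intro _
    refine ⟨∅, by simp, by simp, fun t => ?_⟩
    simpa using HilbF_base _ t
  | succ j ih =>
    intro hj
    obtain ⟨s, hs, hsq, hH⟩ := ih (by omega)
    set I := Ideal.span (s : Set (MvPolynomial σ K)) with hI
    have hfin : I.minimalPrimes.Finite := Ideal.finite_minimalPrimes_of_isNoetherianRing _ I
    set W := Submodule.span K (Set.range q) with hW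
    have hWdeg : W ≤ restrictTotalDegree σ K 2 := by
      rw [hW, Submodule.span_le]
      rintro _ ⟨i, rfl⟩
      exact (mem_restrictTotalDegree _ _ _).2 (hq i)
    let cut : Ideal (MvPolynomial σ K) → Subspace K W := fun P =>
      (P.restrictScalars K).comap W.subtype
    have hinf : Infinite K := IsAlgClosed.instInfinite
    have hcut : ⊤ ∉ hfin.toFinset.image cut := by
      intro h
      simp only [Finset.mem_image, Set.Finite.mem_toFinset] at h
      obtain ⟨P, hP, hPt⟩ := h
      have hqP : ∀ i, q i ∈ P := by
        intro i
        have : (⟨q i, Submodule.subset_span ⟨i, rfl⟩⟩ : W) ∈ cut P := by rw [hPt]; trivial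
        exact this
      have h1 := hdim P hP.1.1 hqP
      have h2 := dim_ge s P hP
      have h3 : (Fintype.card σ : WithBot ℕ∞) ≤ (D : WithBot ℕ∞) + (j : WithBot ℕ∞) :=
        h2.trans (add_le_add h1 (by exact_mod_cast hs))
      have h4 : Fintype.card σ ≤ D + j := by exact_mod_cast h3
      omega
    have := Subspace.biUnion_ne_univ_of_top_notMem hcut
    obtain ⟨f, hf⟩ := (Set.ne_univ_iff_exists_notMem _).1 this
    have hfP : ∀ P ∈ I.minimalPrimes, (f : MvPolynomial σ K) ∉ P := by
      intro P hP hfP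
      apply hf
      simp only [Set.mem_iUnion]
      exact ⟨cut P, Finset.mem_image_of_mem _ (hfin.mem_toFinset.2 hP), hfP⟩
    refine ⟨insert (f : MvPolynomial σ K) s, ?_, ?_, ?_⟩
    · exact (Finset.card_insert_le _ _).trans (by omega)
    · intro g hg
      rcases Finset.mem_insert.1 hg with rfl | hg
      · exact f.2
      · exact hsq g hg
    · intro t
      have hreg : ∀ g, (f : MvPolynomial σ K) * g ∈ I.radical → g ∈ I.radical := by
        intro g hg
        rw [← Ideal.sInf_minimalPrimes] at hg ⊢
        rw [Submodule.mem_sInf] at hg ⊢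
        intro P hP
        exact (hP.1.1.mem_or_mem (hg P hP)).resolve_left (hfP P hP)
      have hle : I.radical ≤ (Ideal.span ((insert (f : MvPolynomial σ K) s : Finset _) : Set (MvPolynomial σ K))).radical :=
        Ideal.radical_mono (Ideal.span_mono (by simp))
      have hmem : (f : MvPolynomial σ K) ∈ (Ideal.span ((insert (f : MvPolynomial σ K) s : Finset _) : Set (MvPolynomial σ K))).radical :=
        Ideal.le_radical (Ideal.subset_span (by simp))
      have h1 := HilbF_mul _ _ (f : MvPolynomial σ K) ((mem_restrictTotalDegree _ _ _).1 (hWdeg f.2)) hreg hle hmem t (t+1)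
      have h2 := hH (t + 2 * (t + 1))
      have h3 := h1.trans h2
      have e1 : t + 2 * (t + 1) + 1 = 3 * (t + 1) := by ring
      obtain ⟨u, hu⟩ : ∃ u, Fintype.card σ - j = u + 1 := ⟨Fintype.card σ - j - 1, by omega⟩
      have hu' : Fintype.card σ - (j + 1) = u := by omega
      rw [e1, hu, mul_pow] at h3
      rw [hu']
      have h4 : 3 ^ (u + 1) ≤ 3 ^ (Fintype.card σ) := Nat.pow_le_pow_right (by norm_num) (by omega)
      refine Nat.le_of_mul_le_mul_left (h3.trans ?_) (Nat.succ_pos t)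
      calc 3 ^ (Fintype.card σ * j) * (3 ^ (u + 1) * (t + 1) ^ (u + 1))
          ≤ 3 ^ (Fintype.card σ * j) * (3 ^ (Fintype.card σ) * (t + 1) ^ (u + 1)) := by gcongr
        _ = _ := by ring

/-- Uniform point count. -/
theorem point_bound {K : Type*} [Field K] [IsAlgClosed K] {σ ι : Type*} [Fintype σ]
    (q : ι → MvPolynomial σ K) (hq : ∀ j, (q j).totalDegree ≤ 2) (D : ℕ)
    (hD : D ≤ Fintype.card σ)
    (hdim : ringKrullDim (MvPolynomial σ K ⧸ vanishingIdeal K {w | ∀ j, eval w (q j) = 0}) ≤ (D : WithBot ℕ∞))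
    (A : Finset K) (s : ℕ) (hA : A.card ≤ s + 1) (Y : Finset (σ → K)) (hYA : ∀ y ∈ Y, ∀ i, y i ∈ A)
    (hY : ∀ y ∈ Y, ∀ j, eval y (q j) = 0) :
    Y.card ≤ 3 ^ (Fintype.card σ * Fintype.card σ) * (Fintype.card σ * s + 1) ^ D := by
  have hdim' : ∀ P : Ideal (MvPolynomial σ K), P.IsPrime → (∀ j, q j ∈ P) →
      ringKrullDim (MvPolynomial σ K ⧸ P) ≤ (D : WithBot ℕ∞) := by
    intro P hP hqP
    refine le_trans ?_ hdim
    have hle : vanishingIdeal K {w | ∀ j, eval w (q j) = 0} ≤ P := by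
      have h1 : vanishingIdeal K (zeroLocus K P) = P := IsPrime.vanishingIdeal_zeroLocus P
      rw [← h1]
      refine vanishingIdeal_anti_mono ?_
      intro w hw j
      exact hw (q j) (hqP j)
    exact ringKrullDim_le_of_surjective (Ideal.Quotient.factor hle) (Ideal.Quotient.factor_surjective hle)
  obtain ⟨S, hS, hSq, hH⟩ := hilb_chain q hq D (Fintype.card σ - D) (by omega) hdim' _ le_rfl
  have h1 := HilbF_interp (Ideal.span (S : Set (MvPolynomial σ K))).radical A s hA Y hYA ?_
  · refine h1.trans ((hH _).trans ?_)
    have e : Fintype.card σ - (Fintype.card σ - D) = D := by omega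
    rw [e]
    gcongr
    · norm_num
    · omega
  · intro y hy f hf
    obtain ⟨k, hk⟩ := hf
    have hker : Ideal.span (S : Set (MvPolynomial σ K)) ≤ RingHom.ker (eval y) := by
      rw [Ideal.span_le]
      intro g hg
      have hg' := hSq g hg
      have : Submodule.span K (Set.range q) ≤ LinearMap.ker (aeval (R := K) y).toLinearMap := by
        rw [Submodule.span_le]
        rintro _ ⟨j, rfl⟩
        exact hY y hy j
      exact this hg'
    have := hker hk
    rw [RingHom.mem_ker, map_pow] at this
    exact eq_zero_of_pow_eq_zero this

theorem class_count (T : ℕ) (S : Finset ℤ) (hS : S ⊆ Finset.Icc (-(T:ℤ)) T) (k : ℕ) (hk : 1 ≤ k)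
    (hkT : k ≤ T) (hd : ∀ a ∈ S, ∀ b ∈ S, (k:ℤ) ∣ a - b) : k * S.card ≤ 3 * T := by
  have h1 : S.card ≤ 2 * T / k + 1 := by
    rw [← Finset.card_range (2 * T / k + 1)]
    refine Finset.card_le_card_of_injOn (fun y => ((y + T) / k).toNat) ?_ ?_
    · intro y hy
      have := Finset.mem_Icc.1 (hS hy)
      rw [Finset.coe_range, Set.mem_Iio, Nat.lt_succ_iff]
      have h2 : (y + T) / k ≤ ((2 * T / k : ℕ) : ℤ) := by
        push_cast
        exact Int.ediv_le_ediv (by positivity) (by linarith)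
      show ((y + T) / k).toNat ≤ 2 * T / k
      exact Int.toNat_le.2 h2
    · intro a ha b hb hab
      have ha' := Finset.mem_Icc.1 (hS ha)
      have hb' := Finset.mem_Icc.1 (hS hb)
      obtain ⟨c, hc⟩ := hd a ha b hb
      have hk0 : (0:ℤ) < k := by exact_mod_cast hk
      have pa : 0 ≤ (a + T) / (k:ℤ) := Int.ediv_nonneg (by linarith) hk0.le
      have pb : 0 ≤ (b + T) / (k:ℤ) := Int.ediv_nonneg (by linarith) hk0.le
      simp only at hab
      have e : (a + T) / (k:ℤ) = (b + T) / (k:ℤ) := by omega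
      have e2 : a + T = (b + T) + k * c := by linarith
      rw [e2, Int.add_mul_ediv_left _ _ hk0.ne'] at e
      have : c = 0 := by linarith
      rw [this] at hc
      linarith
  have h2 : k * (2 * T / k) ≤ 2 * T := Nat.mul_div_le _ _
  calc k * S.card ≤ k * (2 * T / k + 1) := Nat.mul_le_mul_left _ h1
    _ = k * (2 * T / k) + k := by ring
    _ ≤ 3 * T := by omega

theorem dvd_of_gcd (a b z : ℤ) (ha : a ≠ 0) (h : a ∣ b * z) : ((a.natAbs / Int.gcd a b : ℕ) : ℤ) ∣ z := by
  have hg : 0 < Int.gcd a b := Int.gcd_pos_of_ne_zero_left _ ha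
  have h1 : a / (Int.gcd a b : ℤ) ∣ z := by
    have hc : IsCoprime (a / (Int.gcd a b : ℤ)) (b / (Int.gcd a b : ℤ)) :=
      Int.isCoprime_iff_gcd_eq_one.2 (Int.gcd_ediv_gcd_ediv_gcd hg)
    refine hc.dvd_of_dvd_mul_left ?_
    have hgz : ((Int.gcd a b : ℕ) : ℤ) ≠ 0 := by exact_mod_cast hg.ne'
    refine (mul_dvd_mul_iff_left hgz).1 ?_
    rw [Int.mul_ediv_cancel' (Int.gcd_dvd_left _ _), ← mul_assoc, Int.mul_ediv_cancel' (Int.gcd_dvd_right _ _)]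
    exact h
  rw [← Int.dvd_natAbs, Int.natCast_dvd_natCast]
  have h2 := Int.natAbs_dvd_natAbs.2 h1
  rwa [Int.natAbs_ediv_of_dvd (Int.gcd_dvd_left _ _), Int.natAbs_natCast] at h2

theorem lin_count (T : ℕ) (a b c n : ℤ) (ha : a ≠ 0) (haT : a.natAbs ≤ T) :
    a.natAbs * ((Finset.Icc (-(T:ℤ)) T ×ˢ Finset.Icc (-(T:ℤ)) T ×ˢ Finset.Icc (-(T:ℤ)) T).filter
      (fun y => a * y.1 + b * y.2.1 + c * y.2.2 = n)).card ≤
      9 * T ^ 2 * Int.gcd (Int.gcd a b) c := by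
  classical
  set S := ((Finset.Icc (-(T:ℤ)) T ×ˢ Finset.Icc (-(T:ℤ)) T ×ˢ Finset.Icc (-(T:ℤ)) T).filter
      (fun y => a * y.1 + b * y.2.1 + c * y.2.2 = n)) with hS
  set G := Int.gcd a b with hG
  set g := Int.gcd (G:ℤ) c with hg
  have hGpos : 0 < G := Int.gcd_pos_of_ne_zero_left _ ha
  have hgpos : 0 < g := Int.gcd_pos_of_ne_zero_left _ (by exact_mod_cast hGpos.ne')
  have hGa : G ∣ a.natAbs := Int.gcd_dvd_natAbs_left a b
  have hgG : g ∣ G := by simpa using Int.gcd_dvd_natAbs_left (G:ℤ) c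
  have hapos : 0 < a.natAbs := Int.natAbs_pos.2 ha
  have hGa' : G ≤ a.natAbs := Nat.le_of_dvd hapos hGa
  have hgG' : g ≤ G := Nat.le_of_dvd hGpos hgG
  set Y := S.image (fun y => y.2.2) with hY
  have memS : ∀ y, y ∈ S → (-(T:ℤ) ≤ y.1 ∧ y.1 ≤ T) ∧ (-(T:ℤ) ≤ y.2.1 ∧ y.2.1 ≤ T) ∧ (-(T:ℤ) ≤ y.2.2 ∧ y.2.2 ≤ T) ∧
      a * y.1 + b * y.2.1 + c * y.2.2 = n := by
    intro y hy
    simp only [hS, Finset.mem_filter, Finset.mem_product, Finset.mem_Icc] at hy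
    tauto
  have h1 : (G / g) * Y.card ≤ 3 * T := by
    refine class_count T Y ?_ (G / g) (Nat.div_pos hgG' hgpos) ((Nat.div_le_self _ _).trans (hGa'.trans haT)) ?_
    · intro y hy
      obtain ⟨z, hz, rfl⟩ := Finset.mem_image.1 hy
      exact Finset.mem_Icc.2 (memS z hz).2.2.1
    · intro y hy y' hy'
      obtain ⟨z, hz, rfl⟩ := Finset.mem_image.1 hy
      obtain ⟨z', hz', rfl⟩ := Finset.mem_image.1 hy'
      have := dvd_of_gcd (G:ℤ) c (z.2.2 - z'.2.2) (by exact_mod_cast hGpos.ne') ?_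
      · simpa using this
      · have e : c * (z.2.2 - z'.2.2) = a * (z'.1 - z.1) + b * (z'.2.1 - z.2.1) := by
          have := (memS z hz).2.2.2
          have := (memS z' hz').2.2.2
          linarith
        rw [e]
        exact dvd_add (Dvd.dvd.mul_right (Int.gcd_dvd_left _ _) _) (Dvd.dvd.mul_right (Int.gcd_dvd_right _ _) _)
  have h2 : ∀ y ∈ Y, (a.natAbs / G) * (S.filter (fun z => z.2.2 = y)).card ≤ 3 * T := by
    intro y hy
    have hinj : Set.InjOn (fun z : ℤ × ℤ × ℤ => z.2.1) (S.filter (fun z => z.2.2 = y)) := by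
      intro z hz z' hz' hzz
      simp only [Finset.coe_filter, Set.mem_ofPred_eq] at hz hz'
      have e1 := (memS z hz.1).2.2.2
      have e2 := (memS z' hz'.1).2.2.2
      simp only at hzz
      rw [hzz, hz.2] at e1
      rw [hz'.2] at e2
      have : a * z.1 = a * z'.1 := by linarith
      have := mul_left_cancel₀ ha this
      exact Prod.ext this (Prod.ext hzz (hz.2.trans hz'.2.symm))
    rw [← Finset.card_image_of_injOn hinj]
    refine class_count T _ ?_ _ (Nat.div_pos hGa' hGpos) ((Nat.div_le_self _ _).trans haT) ?_
    · intro y hy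
      obtain ⟨z, hz, rfl⟩ := Finset.mem_image.1 hy
      exact Finset.mem_Icc.2 (memS z (Finset.mem_filter.1 hz).1).2.1
    · intro y hy y' hy'
      obtain ⟨z, hz, rfl⟩ := Finset.mem_image.1 hy
      obtain ⟨z', hz', rfl⟩ := Finset.mem_image.1 hy'
      refine dvd_of_gcd a b (z.2.1 - z'.2.1) ha ?_
      have hz := Finset.mem_filter.1 hz
      have hz' := Finset.mem_filter.1 hz'
      refine ⟨z'.1 - z.1, ?_⟩
      have e1 := (memS z hz.1).2.2.2
      have e2 := (memS z' hz'.1).2.2.2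
      rw [hz.2] at e1
      rw [hz'.2] at e2
      linarith
  have h3 : S.card = ∑ y ∈ Y, (S.filter (fun z => z.2.2 = y)).card :=
    Finset.card_eq_sum_card_image _ _
  have h4 : (a.natAbs / G) * S.card ≤ Y.card * (3 * T) := by
    rw [h3, Finset.mul_sum]
    simpa using Finset.sum_le_card_nsmul Y _ (3 * T) h2
  have e : a.natAbs = g * (G / g) * (a.natAbs / G) := by
    rw [Nat.mul_div_cancel' hgG, Nat.mul_div_cancel' hGa]
  calc a.natAbs * S.card = g * (G / g) * ((a.natAbs / G) * S.card) := by
        conv_lhs => rw [e]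
        ring
    _ ≤ g * (G / g) * (Y.card * (3 * T)) := Nat.mul_le_mul_left _ h4
    _ = g * (3 * T) * ((G / g) * Y.card) := by ring
    _ ≤ g * (3 * T) * (3 * T) := Nat.mul_le_mul_left _ h1
    _ = _ := by ring

theorem sum_inv_sq (T : ℕ) : ∑ e ∈ Finset.Icc 1 T, (1:ℝ) / (e:ℝ) ^ 2 ≤ 2 := by
  have h : ∀ T : ℕ, ∑ e ∈ Finset.Icc 1 (T + 1), (1:ℝ) / (e:ℝ) ^ 2 ≤ 2 - 1 / ((T:ℝ) + 1) := by
    intro T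
    induction T with
    | zero => simp; norm_num
    | succ T ih =>
      rw [Finset.sum_Icc_succ_top (by omega)]
      have : (1:ℝ) / ((T + 1 + 1 : ℕ) : ℝ) ^ 2 ≤ 1 / ((T:ℝ) + 1) - 1 / ((T:ℝ) + 1 + 1) := by
        push_cast
        rw [div_sub_div _ _ (by positivity) (by positivity), div_le_div_iff₀ (by positivity) (by positivity)]
        nlinarith [(Nat.cast_nonneg T : (0:ℝ) ≤ T)]
      push_cast at *
      linarith
  rcases T with _ | T
  · simp
  · refine (h T).trans ?_
    have : (0:ℝ) ≤ 1 / ((T:ℝ) + 1) := by positivity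
    linarith

theorem mult_count (T : ℕ) (e : ℕ) (he : 1 ≤ e) (heT : e ≤ T) :
    (((Finset.Icc (-(T:ℤ)) T).filter (fun x => (e:ℤ) ∣ x)).card : ℝ) ≤ 3 * T / e := by
  have := class_count T ((Finset.Icc (-(T:ℤ)) T).filter (fun x => (e:ℤ) ∣ x)) (Finset.filter_subset _ _) e he heT
    (fun a ha b hb => dvd_sub (Finset.mem_filter.1 ha).2 (Finset.mem_filter.1 hb).2)
  have he' : (0:ℝ) < e := by exact_mod_cast he
  rw [le_div_iff₀ he', mul_comm]
  exact_mod_cast this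

/-- The triples with maximal first coordinate. -/
noncomputable def tri (T : ℕ) : Finset (ℤ × ℤ × ℤ) :=
  (Finset.Icc (-(T:ℤ)) T ×ˢ Finset.Icc (-(T:ℤ)) T ×ˢ Finset.Icc (-(T:ℤ)) T).filter
    (fun x => x.1 ≠ 0 ∧ x.2.1.natAbs ≤ x.1.natAbs ∧ x.2.2.natAbs ≤ x.1.natAbs)

theorem gcd_sum (T : ℕ) :
    ∑ x ∈ tri T, (Int.gcd (Int.gcd x.1 x.2.1) x.2.2 : ℝ) / (x.1.natAbs : ℝ) ≤ 54 * (T:ℝ) ^ 2 := by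
  classical
  let P : ℕ → ℤ × ℤ × ℤ → Prop := fun e x => (e:ℤ) ∣ x.1 ∧ (e:ℤ) ∣ x.2.1 ∧ (e:ℤ) ∣ x.2.2
  have h1 : ∀ x ∈ tri T, (Int.gcd (Int.gcd x.1 x.2.1) x.2.2 : ℝ) / (x.1.natAbs : ℝ) ≤
      ∑ e ∈ Finset.Icc 1 T, if P e x then (e:ℝ) / (x.1.natAbs : ℝ) else 0 := by
    intro x hx
    simp only [tri, Finset.mem_filter, Finset.mem_product, Finset.mem_Icc] at hx
    set g := Int.gcd (Int.gcd x.1 x.2.1) x.2.2 with hg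
    have d1 : (g:ℤ) ∣ (Int.gcd x.1 x.2.1 : ℤ) := Int.gcd_dvd_left _ _
    have hP : P g x := ⟨d1.trans (Int.gcd_dvd_left _ _), d1.trans (Int.gcd_dvd_right _ _), Int.gcd_dvd_right _ _⟩
    have hgpos : 0 < g := Int.gcd_pos_of_ne_zero_left _ (by
      exact_mod_cast (Int.gcd_pos_of_ne_zero_left _ hx.2.1).ne')
    have hgle : g ≤ x.1.natAbs := Nat.le_of_dvd (Int.natAbs_pos.2 hx.2.1) (Int.natCast_dvd.1 hP.1)
    have hgT : g ∈ Finset.Icc 1 T := Finset.mem_Icc.2 ⟨hgpos, by omega⟩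
    have := Finset.single_le_sum (f := fun e : ℕ => if P e x then (e:ℝ) / (x.1.natAbs : ℝ) else 0)
      (fun e _ => by positivity) hgT
    simpa [hP] using this
  refine (Finset.sum_le_sum h1).trans ?_
  rw [Finset.sum_comm]
  have h2 : ∀ e ∈ Finset.Icc 1 T, (∑ x ∈ tri T, if P e x then (e:ℝ) / (x.1.natAbs : ℝ) else 0) ≤
      27 * (T:ℝ) ^ 2 * (1 / (e:ℝ) ^ 2) := by
    intro e he
    have he := Finset.mem_Icc.1 he
    have he0 : (0:ℝ) < e := by exact_mod_cast he.1
    rw [← Finset.sum_filter]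
    set A := ((Finset.Icc (-(T:ℤ)) T).filter (fun x => (e:ℤ) ∣ x)) with hA
    have hmaps : ∀ x ∈ (tri T).filter (P e), x.1 ∈ A.filter (· ≠ 0) := by
      intro x hx
      simp only [tri, Finset.mem_filter, Finset.mem_product, Finset.mem_Icc, P, hA] at hx ⊢
      tauto
    rw [← Finset.sum_fiberwise_of_maps_to hmaps]
    have h3 : ∀ a ∈ A.filter (· ≠ 0), (∑ x ∈ ((tri T).filter (P e)).filter (fun x => x.1 = a), (e:ℝ) / (x.1.natAbs : ℝ)) ≤
        9 * (T:ℝ) / e := by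
      intro a ha
      have ha := Finset.mem_filter.1 ha
      have ha1 := Finset.mem_filter.1 ha.1
      have haI := Finset.mem_Icc.1 ha1.1
      have ha0 : a ≠ 0 := ha.2
      have hea : e ≤ a.natAbs := Nat.le_of_dvd (Int.natAbs_pos.2 ha0) (Int.natCast_dvd.1 ha1.2)
      have hcard : ((((tri T).filter (P e)).filter (fun x => x.1 = a)).card : ℝ) ≤ (3 * a.natAbs / e) * (3 * a.natAbs / e) := by
        set Bx := ((Finset.Icc (-((a.natAbs : ℕ):ℤ)) (a.natAbs:ℕ)).filter (fun x => (e:ℤ) ∣ x))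
        have hle : (((tri T).filter (P e)).filter (fun x => x.1 = a)).card ≤ (Bx ×ˢ Bx).card := by
          refine Finset.card_le_card_of_injOn (fun x => x.2) ?_ ?_
          · intro x hx
            simp only [tri, Finset.coe_filter, Finset.mem_filter, Finset.mem_product, Finset.mem_Icc, P, Set.mem_ofPred_eq] at hx
            simp only [Bx, Finset.coe_product, Set.mem_prod, Finset.mem_coe, Finset.mem_filter, Finset.mem_Icc]
            obtain ⟨⟨⟨_, _, h5, h6⟩, _, h7, h8⟩, h9⟩ := hx
            rw [h9] at h5 h6
            refine ⟨⟨?_, h7⟩, ?_, h8⟩ <;> omega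
          · intro x hx y hy hxy
            simp only [Finset.coe_filter, Set.mem_ofPred_eq] at hx hy
            exact Prod.ext (hx.2.trans hy.2.symm) hxy
        have hB := mult_count a.natAbs e he.1 hea
        rw [Finset.card_product] at hle
        calc ((((tri T).filter (P e)).filter (fun x => x.1 = a)).card : ℝ) ≤ ((Bx.card * Bx.card : ℕ) : ℝ) := by exact_mod_cast hle
          _ = (Bx.card : ℝ) * Bx.card := by push_cast; ring
          _ ≤ _ := mul_le_mul hB hB (by positivity) (by positivity)
      have hapos : (0:ℝ) < a.natAbs := by exact_mod_cast Int.natAbs_pos.2 ha0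
      have haT : (a.natAbs : ℝ) ≤ T := by
        have : a.natAbs ≤ T := by omega
        exact_mod_cast this
      rw [Finset.sum_congr rfl (g := fun _ => (e:ℝ) / (a.natAbs:ℝ)) (by
        intro x hx
        rw [(Finset.mem_filter.1 hx).2]), Finset.sum_const, nsmul_eq_mul]
      calc _ ≤ (3 * (a.natAbs:ℝ) / e) * (3 * a.natAbs / e) * ((e:ℝ) / (a.natAbs:ℝ)) := by gcongr
        _ = 9 * a.natAbs / e := by field_simp; ring
        _ ≤ _ := by gcongr
    refine (Finset.sum_le_card_nsmul _ _ _ h3).trans ?_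
    rw [nsmul_eq_mul]
    have h4 : ((A.filter (· ≠ 0)).card : ℝ) ≤ 3 * T / e :=
      le_trans (by exact_mod_cast Finset.card_filter_le _ _) (mult_count T e he.1 he.2)
    calc _ ≤ (3 * (T:ℝ) / e) * (9 * T / e) := by gcongr
      _ = _ := by field_simp; ring
  refine (Finset.sum_le_sum h2).trans ?_
  rw [← Finset.mul_sum]
  have := sum_inv_sq T
  nlinarith [sq_nonneg (T:ℝ)]

noncomputable def zbox (d T : ℕ) : Finset (Fin d → ℤ) :=
  Fintype.piFinset fun _ => Finset.Icc (-(T:ℤ)) T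

theorem mem_zbox (d T : ℕ) (x : Fin d → ℤ) : x ∈ zbox d T ↔ ∀ k, |x k| ≤ T := by
  simp [zbox, abs_le]

theorem card_Icc_T (T : ℕ) : (Finset.Icc (-(T:ℤ)) T).card = 2 * T + 1 := by
  rw [Int.card_Icc]; omega

theorem card_zbox (d T : ℕ) : (zbox d T).card = (2 * T + 1) ^ d := by
  simp only [zbox, Fintype.card_piFinset, card_Icc_T]
  simp

noncomputable def zpairs (d T : ℕ) (n : ℤ) : Finset ((Fin d → ℤ) × (Fin d → ℤ)) :=
  (zbox d T ×ˢ zbox d T).filter (fun p => ∑ k, p.1 k * p.2 k = n)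

theorem tri_pairs (T : ℕ) (n : ℤ) :
    ((tri T ×ˢ (Finset.Icc (-(T:ℤ)) T ×ˢ Finset.Icc (-(T:ℤ)) T ×ˢ Finset.Icc (-(T:ℤ)) T)).filter
      (fun p => p.1.1 * p.2.1 + p.1.2.1 * p.2.2.1 + p.1.2.2 * p.2.2.2 = n)).card ≤ 486 * T ^ 4 := by
  classical
  set U := ((tri T ×ˢ (Finset.Icc (-(T:ℤ)) T ×ˢ Finset.Icc (-(T:ℤ)) T ×ˢ Finset.Icc (-(T:ℤ)) T)).filter
      (fun p => p.1.1 * p.2.1 + p.1.2.1 * p.2.2.1 + p.1.2.2 * p.2.2.2 = n)) with hU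
  have hmaps : ∀ p ∈ U, p.1 ∈ tri T := by
    intro p hp
    exact (Finset.mem_product.1 (Finset.mem_filter.1 hp).1).1
  have h1 := Finset.card_eq_sum_card_fiberwise (f := Prod.fst) (s := U) (t := tri T) hmaps
  have h2 : ∀ x ∈ tri T, ((U.filter (fun p => p.1 = x)).card : ℝ) ≤
      9 * (T:ℝ) ^ 2 * ((Int.gcd (Int.gcd x.1 x.2.1) x.2.2 : ℝ) / (x.1.natAbs : ℝ)) := by
    intro x hx
    have hx' := hx
    simp only [tri, Finset.mem_filter, Finset.mem_product, Finset.mem_Icc] at hx'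
    have hl := lin_count T x.1 x.2.1 x.2.2 n hx'.2.1 (by omega)
    have hc : (U.filter (fun p => p.1 = x)).card ≤
      ((Finset.Icc (-(T:ℤ)) T ×ˢ Finset.Icc (-(T:ℤ)) T ×ˢ Finset.Icc (-(T:ℤ)) T).filter
      (fun y => x.1 * y.1 + x.2.1 * y.2.1 + x.2.2 * y.2.2 = n)).card := by
      refine Finset.card_le_card_of_injOn Prod.snd ?_ ?_
      · intro p hp
        have hp := Finset.mem_filter.1 hp
        have hp1 := Finset.mem_filter.1 hp.1
        refine Finset.mem_filter.2 ⟨(Finset.mem_product.1 hp1.1).2, ?_⟩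
        rw [← hp.2]
        exact hp1.2
      · intro p hp p' hp' h
        exact Prod.ext ((Finset.mem_filter.1 hp).2.trans (Finset.mem_filter.1 hp').2.symm) h
    have hpos : (0:ℝ) < x.1.natAbs := by exact_mod_cast Int.natAbs_pos.2 hx'.2.1
    have h3 := (Nat.mul_le_mul_left x.1.natAbs hc).trans hl
    rw [← mul_div_assoc, le_div_iff₀ hpos, mul_comm]
    exact_mod_cast h3
  have h3 : (U.card : ℝ) ≤ 486 * (T:ℝ) ^ 4 := by
    rw [h1]
    push_cast
    refine (Finset.sum_le_sum h2).trans ?_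
    rw [← Finset.mul_sum]
    have := gcd_sum T
    calc _ ≤ 9 * (T:ℝ) ^ 2 * (54 * (T:ℝ) ^ 2) := by gcongr
      _ = _ := by ring
  exact_mod_cast h3

theorem zpairs_three (T : ℕ) (hT : 1 ≤ T) (n : ℤ) : (zpairs 3 T n).card ≤ 1485 * T ^ 4 := by
  classical
  let Z := ({0} : Finset (Fin 3 → ℤ)) ×ˢ zbox 3 T
  let Om : Fin 3 → Finset ((Fin 3 → ℤ) × (Fin 3 → ℤ)) := fun i =>
    (zpairs 3 T n).filter (fun p => p.1 i ≠ 0 ∧ ∀ k, (p.1 k).natAbs ≤ (p.1 i).natAbs)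
  have hsub : zpairs 3 T n ⊆ Z ∪ Finset.univ.biUnion Om := by
    intro p hp
    obtain ⟨i, hi⟩ := Finite.exists_max (fun k => (p.1 k).natAbs)
    by_cases h0 : p.1 i = 0
    · refine Finset.mem_union_left _ (Finset.mem_product.2 ⟨?_, (Finset.mem_product.1 (Finset.mem_filter.1 hp).1).2⟩)
      rw [Finset.mem_singleton]
      ext k
      have := hi k
      rw [h0] at this
      simpa using this
    · refine Finset.mem_union_right _ (Finset.mem_biUnion.2 ⟨i, Finset.mem_univ _, ?_⟩)
      exact Finset.mem_filter.2 ⟨hp, h0, hi⟩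
  have hZ : Z.card ≤ 27 * T ^ 4 := by
    rw [Finset.card_product, card_zbox]
    simp only [Finset.card_singleton, one_mul]
    calc (2 * T + 1) ^ 3 ≤ (3 * T) ^ 3 := by gcongr; omega
      _ = 27 * T ^ 3 := by ring
      _ ≤ _ := by gcongr; omega
  have hOm : ∀ i ∈ (Finset.univ : Finset (Fin 3)), (Om i).card ≤ 486 * T ^ 4 := by
    intro i _
    refine le_trans ?_ (tri_pairs T n)
    refine Finset.card_le_card_of_injOn
      (fun p => ((p.1 i, p.1 (i+1), p.1 (i+2)), (p.2 i, p.2 (i+1), p.2 (i+2)))) ?_ ?_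
    · intro p hp
      have hp := Finset.mem_filter.1 hp
      have hp1 := Finset.mem_filter.1 hp.1
      have hp2 := Finset.mem_product.1 hp1.1
      rw [mem_zbox, mem_zbox] at hp2
      have hx := fun k => abs_le.1 (hp2.1 k)
      have hy := fun k => abs_le.1 (hp2.2 k)
      simp only [Finset.mem_coe, Finset.mem_filter, Finset.mem_product, Finset.mem_Icc, tri]
      refine ⟨⟨⟨⟨hx _, hx _, hx _⟩, hp.2.1, hp.2.2 _, hp.2.2 _⟩, hy _, hy _, hy _⟩, ?_⟩
      rw [← hp1.2, Fin.sum_univ_three]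
      fin_cases i <;> simp <;> ring
    · intro p _ p' _ h
      simp only [Prod.mk.injEq] at h
      obtain ⟨⟨h1, h2, h3⟩, h4, h5, h6⟩ := h
      refine Prod.ext ?_ ?_ <;> ext k <;> fin_cases i <;> fin_cases k <;> assumption
  calc _ ≤ (Z ∪ Finset.univ.biUnion Om).card := Finset.card_le_card hsub
    _ ≤ Z.card + (Finset.univ.biUnion Om).card := Finset.card_union_le _ _
    _ ≤ 27 * T ^ 4 + 3 * (486 * T ^ 4) := by
      refine Nat.add_le_add hZ ?_
      refine (Finset.card_biUnion_le).trans ?_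
      simpa using Finset.sum_le_card_nsmul _ _ _ hOm
    _ = _ := by ring

theorem zpairs_bound (k : ℕ) (T : ℕ) (hT : 1 ≤ T) : ∀ n : ℤ,
    (zpairs (k + 3) T n).card ≤ 1485 * 9 ^ k * T ^ (2 * (k + 2)) := by
  classical
  induction k with
  | zero => intro n; simpa using zpairs_three T hT n
  | succ k ih =>
    intro n
    set I := Finset.Icc (-(T:ℤ)) T
    have hmaps : ∀ p ∈ zpairs (k + 1 + 3) T n, (p.1 0, p.2 0) ∈ I ×ˢ I := by
      intro p hp
      have hp1 := Finset.mem_filter.1 hp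
      have hp2 := Finset.mem_product.1 hp1.1
      rw [mem_zbox, mem_zbox] at hp2
      exact Finset.mem_product.2 ⟨Finset.mem_Icc.2 (abs_le.1 (hp2.1 0)), Finset.mem_Icc.2 (abs_le.1 (hp2.2 0))⟩
    rw [Finset.card_eq_sum_card_fiberwise hmaps]
    have hfib : ∀ u ∈ I ×ˢ I, ((zpairs (k + 1 + 3) T n).filter (fun p => (p.1 0, p.2 0) = u)).card ≤
        1485 * 9 ^ k * T ^ (2 * (k + 2)) := by
      intro u _
      refine le_trans ?_ (ih (n - u.1 * u.2))
      refine Finset.card_le_card_of_injOn (fun p => (fun i => p.1 (Fin.succ i), fun i => p.2 (Fin.succ i))) ?_ ?_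
      · intro p hp
        have hp := Finset.mem_filter.1 hp
        have hp1 := Finset.mem_filter.1 hp.1
        have hp2 := Finset.mem_product.1 hp1.1
        rw [mem_zbox, mem_zbox] at hp2
        refine Finset.mem_filter.2 ⟨Finset.mem_product.2 ⟨?_, ?_⟩, ?_⟩
        · rw [mem_zbox]; exact fun k => hp2.1 _
        · rw [mem_zbox]; exact fun k => hp2.2 _
        · have h3 := hp1.2
          have h4 := hp.2
          rw [← h4]
          rw [Fin.sum_univ_succ] at h3
          simp only
          linarith
      · intro p hp p' hp' h
        have h1 := (Finset.mem_filter.1 hp).2.trans (Finset.mem_filter.1 hp').2.symm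
        simp only [Prod.mk.injEq] at h1 h
        refine Prod.ext ?_ ?_
        · ext i
          refine Fin.cases h1.1 (fun i => congrFun h.1 i) i
        · ext i
          refine Fin.cases h1.2 (fun i => congrFun h.2 i) i
    refine (Finset.sum_le_card_nsmul _ _ _ hfib).trans ?_
    rw [Finset.card_product, card_Icc_T, smul_eq_mul]
    calc _ ≤ (3 * T) * (3 * T) * (1485 * 9 ^ k * T ^ (2 * (k + 2))) := by gcongr <;> omega
      _ = _ := by ring

def betaK (d : ℕ) : Matrix (Fin (d+3)) (Fin (d+3)) ℤ := fun i j =>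
  if i.1 < 2 ∧ 2 ≤ j.1 then 1 else if 2 ≤ i.1 ∧ j.1 < 2 then -1 else 0

theorem betaK_not_MC (d : ℕ) (hd : 3 ≤ d) (K : Type*) [Field K] [Infinite K]
    (h : MainConj (d+3) d K (betaK d)) : False := by
  have hdpos : 0 < d := by omega
  let e0 : Fin d := ⟨0, by omega⟩
  let e1 : Fin d := ⟨1, by omega⟩
  have h0lt : 0 < d + 3 - 2 := by omega
  have h01 : e0 ≠ e1 := by simp [e0, e1]
  let z1 : Fin d → K := Pi.single e0 1
  let v : Fin d → K := Pi.single e1 1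
  have hzv : ∑ k, z1 k * v k = 0 := by
    apply Finset.sum_eq_zero
    intro k _
    by_cases hk : k = e0
    · subst hk; simp [v, h01]
    · simp [z1, hk]
  have hz1 : z1 ≠ 0 := by
    intro h0
    have := congrFun h0 e0
    simp [z1] at this
  have hv : v ≠ 0 := by
    intro h0
    have := congrFun h0 e1
    simp [v] at this
  have H := h z1 v hzv hz1 hv
  set V : Set (Fin (d+3-2) × Fin d → K) :=
    {w | ∀ j, MvPolynomial.eval w (qPolyInt (d+3) d K (betaK d) z1 v j) = 0} with hV
  let g : Fin (d+3-2) × Fin d → MvPolynomial (Fin d × Fin d) K := fun jk =>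
    if hj : jk.1.1 = 0 then C (- z1 jk.2) else X (⟨jk.1.1 - 1, by have := jk.1.2; omega⟩, jk.2)
  let φ : MvPolynomial (Fin (d+3-2) × Fin d) K →ₐ[K] MvPolynomial (Fin d × Fin d) K := aeval g
  have hsurj : Function.Surjective φ := by
    rw [← AlgHom.range_eq_top, eq_top_iff, ← MvPolynomial.adjoin_range_X, Algebra.adjoin_le_iff]
    rintro _ ⟨⟨j, k⟩, rfl⟩
    refine ⟨X (⟨j.1+1, by have := j.2; omega⟩, k), ?_⟩
    simp [φ, g]
  have hpt : ∀ x : Fin d × Fin d → K, (fun jk => eval x (g jk)) ∈ V := by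
    intro x
    rw [hV]
    intro j
    have hw0 : ∀ k, eval x (g (⟨0, h0lt⟩, k)) = - z1 k := by intro k; simp [g]
    simp only [qPolyInt, map_sum, map_mul, map_add, eval_X, eval_C]
    by_cases hj : j.1 = 0
    · have hj' : j = ⟨0, h0lt⟩ := Fin.ext hj
      subst hj'
      rw [← neg_eq_zero, ← hzv, ← Finset.sum_neg_distrib]
      apply Finset.sum_congr rfl
      intro k _
      rw [hw0]
      rw [Finset.sum_eq_zero]
      · simp [betaK]
      · intro i _
        by_cases hi : i.1 = 0
        · simp [betaK, hi]
        · have : 2 ≤ i.1 + 1 := by omega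
          simp [betaK, this]
    · apply Finset.sum_eq_zero
      intro k _
      rw [Finset.sum_eq_single (⟨0, by omega⟩ : Fin (d+3-2))]
      · rw [hw0]
        have : 2 ≤ j.1 + 1 := by omega
        have h3 : ¬ (j.1 + 1 < 2) := by omega
        simp [betaK, hj]
      · intro i _ hi
        have hi' : 2 ≤ i.1 + 1 := by
          have : i.1 ≠ 0 := fun h => hi (Fin.ext h)
          omega
        have h1 : 2 ≤ j.1 + 1 := by omega
        simp [betaK, hj]
        intro _ h7
        omega
      · simp
  have hker : ∀ f ∈ vanishingIdeal K V, φ f = 0 := by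
    intro f hf
    apply MvPolynomial.funext
    intro x
    rw [map_zero]
    have h1 : eval (fun jk => eval x (g jk)) f = 0 := by
      have := (mem_vanishingIdeal_iff.1 hf) _ (hpt x)
      rwa [aeval_eq_eval] at this
    rw [← h1]
    have : ((aeval x : _ →ₐ[K] K).comp φ) = aeval (fun jk => eval x (g jk)) := by
      apply MvPolynomial.algHom_ext
      intro i
      simp [φ]
    have := congrArg (fun t => t f) this
    exact this
  have hdim : ringKrullDim (MvPolynomial (Fin d × Fin d) K) ≤
      ringKrullDim (MvPolynomial (Fin (d+3-2) × Fin d) K ⧸ vanishingIdeal K V) :=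
    ringKrullDim_le_of_surjective
      (Ideal.Quotient.lift (vanishingIdeal K V) (φ : _ →+* _) hker)
      (Ideal.Quotient.lift_surjective_of_surjective _ _ hsurj)
  rw [H, MvPolynomial.ringKrullDim_of_isNoetherianRing, ringKrullDim_eq_zero_of_field] at hdim
  have h5 : d * d ≤ (d + 3 - 2) * (d - 1) := by
    have : (((d * d : ℕ) : ℕ∞) : WithBot ℕ∞) ≤ (((d + 3 - 2) * (d - 1) : ℕ) : WithBot ℕ∞) := by
      simpa using hdim
    have h6 : ((d * d : ℕ) : ℕ∞) ≤ (((d + 3 - 2) * (d - 1) : ℕ) : ℕ∞) := WithBot.coe_le_coe.1 this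
    exact_mod_cast h6
  obtain ⟨c, rfl⟩ := Nat.exists_eq_add_of_le hd
  have e1 : 3 + c + 3 - 2 = c + 4 := by omega
  have e2 : 3 + c - 1 = c + 2 := by omega
  rw [e1, e2] at h5
  nlinarith

theorem N_bound (d N : ℕ) (hd : 3 ≤ d)
    (hMC : ∀ (p : ℕ) [Fact p.Prime], ∀ (M : ℕ) (_h2 : 1 < M) (_hMN : M ≤ N)
        (β : Matrix (Fin M) (Fin M) ℤ),
        (∀ i j, β j i = -β i j) →
        (∀ i j, β i j = -1 ∨ β i j = 0 ∨ β i j = 1) →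
        (∀ i, ∃ j, β i j ≠ 0) →
        β ⟨0, by omega⟩ ⟨M - 1, by omega⟩ = 1 →
        MatIrreducible β →
        MainConj M d (AlgebraicClosure (ZMod p)) β) : N ≤ d + 2 := by
  by_contra hN
  have : Fact (Nat.Prime 2) := ⟨Nat.prime_two⟩
  have : Infinite (AlgebraicClosure (ZMod 2)) := IsAlgClosed.instInfinite
  have hz : ∀ j : Fin (d+3), 2 ≤ j.1 → betaK d ⟨0, by omega⟩ j ≠ 0 := by
    intro j hj; simp [betaK, hj]
  have hz1 : ∀ j : Fin (d+3), 2 ≤ j.1 → betaK d ⟨1, by omega⟩ j ≠ 0 := by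
    intro j hj; simp [betaK, hj]
  have hsk : ∀ i j, betaK d j i = - betaK d i j := by
    intro i j
    simp only [betaK]
    split_ifs <;> omega
  have hz' : ∀ j : Fin (d+3), ∀ i : Fin (d+3), 2 ≤ j.1 → i.1 < 2 → betaK d j i ≠ 0 := by
    intro j i hj hi
    have : ¬ (j.1 < 2) := by omega
    simp [betaK, hj, hi, this]
  have hz'' : ∀ j : Fin (d+3), ∀ i : Fin (d+3), 2 ≤ j.1 → i.1 < 2 → betaK d i j ≠ 0 := by
    intro j i hj hi
    simp [betaK, hj, hi]
  refine betaK_not_MC d hd (AlgebraicClosure (ZMod 2))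
    (hMC 2 (d+3) (by omega) (by omega) (betaK d) hsk ?_ ?_ ?_ ?_)
  · intro i j
    simp only [betaK]
    split_ifs <;> simp
  · intro i
    by_cases hi : i.1 < 2
    · exact ⟨⟨2, by omega⟩, hz'' _ _ (le_refl 2) hi⟩
    · exact ⟨⟨0, by omega⟩, hz' _ _ (by omega) (by simp)⟩
  · simp [betaK]
  · intro I ⟨a, ha⟩ ⟨b, hb⟩
    by_cases ha2 : a.1 < 2 <;> by_cases hb2 : b.1 < 2
    · let c : Fin (d+3) := ⟨2, by omega⟩
      by_cases hc : c ∈ I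
      · exact ⟨c, hc, b, hb, hz' _ _ (le_refl 2) hb2⟩
      · exact ⟨a, ha, c, hc, hz'' _ _ (le_refl 2) ha2⟩
    · exact ⟨a, ha, b, hb, hz'' _ _ (by omega) ha2⟩
    · exact ⟨a, ha, b, hb, hz' _ _ (by omega) hb2⟩
    · let c : Fin (d+3) := ⟨0, by omega⟩
      by_cases hc : c ∈ I
      · exact ⟨c, hc, b, hb, hz'' _ _ (by omega) (by simp [c])⟩
      · exact ⟨a, ha, c, hc, hz' _ _ (by omega) (by simp [c])⟩

open Classical in
noncomputable def solS (ι : Type) [Fintype ι] (α : Matrix ι ι ℤ) (d T : ℕ) :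
    Finset (ι → Fin d → ℤ) :=
  (Fintype.piFinset fun _ => zbox d T).filter
    (fun z => (∀ j, z j ≠ 0) ∧ ∀ j, ∑ k, z j k * ∑ i, α j i * z i k = 0)

theorem mem_solS {ι : Type} [Fintype ι] {α : Matrix ι ι ℤ} {d T : ℕ} {z : ι → Fin d → ℤ} :
    z ∈ solS ι α d T ↔ (∀ j k, |z j k| ≤ T) ∧ (∀ j, z j ≠ 0) ∧
      ∀ j, ∑ k, z j k * ∑ i, α j i * z i k = 0 := by
  simp [solS, mem_zbox]

theorem sum_split3 {A : Type*} [AddCommMonoid A] (M : ℕ) (hM : 2 ≤ M) (f : Fin M → A) :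
    ∑ i, f i = f ⟨0, by omega⟩ + ∑ i : Fin (M-2), f ⟨i.1+1, by omega⟩ + f ⟨M-1, by omega⟩ := by
  obtain ⟨m, rfl⟩ := Nat.exists_eq_add_of_le' hM
  rw [Fin.sum_univ_castSucc, Fin.sum_univ_succ]
  rfl

theorem cast_inj_of_small {K : Type*} [Field K] (p : ℕ) [CharP K p] (a b : ℤ) (h : |a - b| < p)
    (hab : (a : K) = b) : a = b := by
  have h1 : ((a - b : ℤ) : K) = 0 := by push_cast; rw [hab, sub_self]
  rw [CharP.intCast_eq_zero_iff K p] at h1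
  have := Int.eq_zero_of_abs_lt_dvd h1 h
  omega

theorem qPoly_deg (M d : ℕ) (K : Type*) [Field K] (β : Matrix (Fin M) (Fin M) ℤ) (z1 v : Fin d → K)
    (j : Fin (M-2)) : (qPolyInt M d K β z1 v j).totalDegree ≤ 2 := by
  unfold qPolyInt
  refine totalDegree_finsetSum_le ?_
  intro k _
  refine (totalDegree_mul _ _).trans ?_
  have h1 : (X (j, k) : MvPolynomial (Fin (M-2) × Fin d) K).totalDegree ≤ 1 := by simp
  refine (add_le_add h1 (c := _) (d := 1) ?_).trans (by norm_num)
  refine (totalDegree_add _ _).trans (max_le ?_ ?_)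
  · rw [totalDegree_C]; norm_num
  · refine totalDegree_finsetSum_le ?_
    intro i _
    refine (totalDegree_mul _ _).trans ?_
    rw [totalDegree_C, totalDegree_X]

theorem qPoly_eval (M d : ℕ) (hM : 2 ≤ M) (K : Type*) [Field K] (β : Matrix (Fin M) (Fin M) ℤ)
    (h0 : β ⟨0, by omega⟩ ⟨0, by omega⟩ = 0)
    (h1 : β ⟨0, by omega⟩ ⟨M - 1, by omega⟩ = 1) (z : Fin M → Fin d → ℤ) (z1 v : Fin d → K)
    (hz1 : ∀ k, z1 k = z ⟨0, by omega⟩ k)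
    (hv : ∀ k, v k = ((∑ i, β ⟨0, by omega⟩ i * z i k : ℤ) : K)) (j : Fin (M-2)) :
    eval (fun jk : Fin (M-2) × Fin d => (z ⟨jk.1.1+1, by have := jk.1.2; omega⟩ jk.2 : K))
      (qPolyInt M d K β z1 v j) =
    ((∑ k, z ⟨j.1+1, by have := j.2; omega⟩ k * ∑ i, β ⟨j.1+1, by have := j.2; omega⟩ i * z i k : ℤ) : K) := by
  simp only [qPolyInt, map_sum, map_mul, map_add, eval_X, eval_C]
  rw [Int.cast_sum]
  refine Finset.sum_congr rfl fun k _ => ?_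
  rw [Int.cast_mul]
  congr 1
  rw [hz1, hv, sum_split3 M hM, sum_split3 M hM, h0, h1]
  push_cast
  have : ∑ x : Fin (M-2), ((β ⟨j.1 + 1, by have := j.2; omega⟩ ⟨x.1 + 1, by have := x.2; omega⟩ : K) -
        β ⟨j.1 + 1, by have := j.2; omega⟩ ⟨M - 1, by omega⟩ * β ⟨0, by omega⟩ ⟨x.1 + 1, by have := x.2; omega⟩) *
      (z ⟨x.1 + 1, by have := x.2; omega⟩ k : K) =
      ∑ x : Fin (M-2), (β ⟨j.1 + 1, by have := j.2; omega⟩ ⟨x.1 + 1, by have := x.2; omega⟩ : K) * (z ⟨x.1 + 1, by have := x.2; omega⟩ k : K)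
      - β ⟨j.1 + 1, by have := j.2; omega⟩ ⟨M - 1, by omega⟩ *
       ∑ x : Fin (M-2), (β ⟨0, by omega⟩ ⟨x.1 + 1, by have := x.2; omega⟩ : K) * (z ⟨x.1 + 1, by have := x.2; omega⟩ k : K) := by
    rw [Finset.mul_sum, ← Finset.sum_sub_distrib]
    refine Finset.sum_congr rfl fun i _ => ?_
    ring
  rw [this]
  ring

open Classical in
theorem fiber_bound (M d T p : ℕ) (hM : 2 ≤ M) (hd : 3 ≤ d) (hT : 1 ≤ T) (K : Type*) [Field K]
    [IsAlgClosed K] [CharP K p] (hp : 2 * M * T < p) (β : Matrix (Fin M) (Fin M) ℤ)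
    (hsk : ∀ i j, β j i = -β i j)
    (hent : ∀ i j, β i j = -1 ∨ β i j = 0 ∨ β i j = 1)
    (h1 : β ⟨0, by omega⟩ ⟨M - 1, by omega⟩ = 1)
    (hMC : MainConj M d K β) :
    ((solS (Fin M) β d T).filter (fun z => ∃ k, ∑ i, β ⟨0, by omega⟩ i * z i k ≠ 0)).card ≤
      (3 ^ (((M-2)*d) * ((M-2)*d)) * (((M-2)*d) * (2*T) + 1) ^ ((M-2)*(d-1))) *
        (1485 * 9^(d-3) * (M*T)^(2*(d-1))) := by
  have h0 : β ⟨0, by omega⟩ ⟨0, by omega⟩ = 0 := by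
    have := hsk ⟨0, by omega⟩ ⟨0, by omega⟩
    omega
  have hMT : 1 ≤ M * T := Nat.mul_pos (by omega) hT
  have hMT2 : T ≤ M * T := Nat.le_mul_of_pos_left _ (by omega)
  have hpM : (((M * T : ℕ) : ℤ)) < p := by
    have : M * T < p := by nlinarith
    exact_mod_cast this
  have hp2 : 2 * (T : ℤ) < p := by
    have : 2 * T < p := by nlinarith
    exact_mod_cast this
  have hzp : (zpairs d (M*T) 0).card ≤ 1485 * 9^(d-3) * (M*T)^(2*(d-1)) := by
    obtain ⟨k, rfl⟩ := Nat.exists_eq_add_of_le' hd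
    exact zpairs_bound k (M*T) hMT 0
  refine le_trans (Finset.card_le_mul_card_image_of_maps_to
    (f := fun z => (z ⟨0, by omega⟩, fun k => ∑ i, β ⟨0, by omega⟩ i * z i k))
    (t := zpairs d (M*T) 0) ?_ _ ?_) (Nat.mul_le_mul_left _ hzp)
  · intro z hz
    rw [Finset.mem_filter, mem_solS] at hz
    obtain ⟨⟨hb, hnz, hs⟩, hv⟩ := hz
    simp only [zpairs, Finset.mem_filter, Finset.mem_product, mem_zbox]
    refine ⟨⟨fun k => (hb _ k).trans (by exact_mod_cast hMT2), fun k => ?_⟩, hs _⟩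
    refine (Finset.abs_sum_le_sum_abs _ _).trans ?_
    have : ∀ i ∈ Finset.univ, |β ⟨0, by omega⟩ i * z i k| ≤ (T : ℤ) := by
      intro i _
      rw [abs_mul]
      have hh := hb i k
      rcases hent ⟨0, by omega⟩ i with h | h | h <;> rw [h] <;> simp <;> omega
    refine (Finset.sum_le_card_nsmul _ _ _ this).trans ?_
    simp
  · rintro ⟨a, b⟩ _
    set F := (((solS (Fin M) β d T).filter
      (fun z => ∃ k, ∑ i, β ⟨0, by omega⟩ i * z i k ≠ 0)).filter
        (fun z => (z ⟨0, by omega⟩, fun k => ∑ i, β ⟨0, by omega⟩ i * z i k) = (a, b))) with hF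
    rcases F.eq_empty_or_nonempty with hE | ⟨y0, hy0⟩
    · rw [hE]; simp
    have hmem : ∀ z ∈ F, (∀ j k, |z j k| ≤ T) ∧ (∀ j, z j ≠ 0) ∧
      (∀ j, ∑ k, z j k * ∑ i, β j i * z i k = 0) ∧ (∃ k, ∑ i, β ⟨0, by omega⟩ i * z i k ≠ 0) ∧
       z ⟨0, by omega⟩ = a ∧ ∀ k, ∑ i, β ⟨0, by omega⟩ i * z i k = b k := by
      intro z hz
      rw [hF, Finset.mem_filter, Finset.mem_filter, mem_solS, Prod.mk.injEq, funext_iff (g := b)] at hz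
      exact ⟨hz.1.1.1, hz.1.1.2.1, hz.1.1.2.2, hz.1.2, hz.2.1, hz.2.2⟩
    obtain ⟨yb, ynz, ys, yv, ya, yb'⟩ := hmem y0 hy0
    let z1 : Fin d → K := fun k => (a k : K)
    let v : Fin d → K := fun k => (b k : K)
    have hs0 : ∑ k, z1 k * v k = 0 := by
      have := ys ⟨0, by omega⟩
      simp only [ya, yb'] at this
      have h2 := congrArg (Int.cast : ℤ → K) this
      push_cast at h2
      exact h2
    have hz1 : z1 ≠ 0 := by
      intro h
      apply ynz ⟨0, by omega⟩
      rw [ya]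
      funext k
      refine cast_inj_of_small (K := K) p _ _ ?_ (by simpa using congrFun h k)
      have := yb ⟨0, by omega⟩ k
      rw [ya] at this
      simp only [Pi.zero_apply, sub_zero]
      omega
    have hbb : ∀ k, |b k| < p := by
      intro k
      rw [← yb' k]
      refine lt_of_le_of_lt (Finset.abs_sum_le_sum_abs _ _) ?_
      have : ∀ i ∈ Finset.univ, |β ⟨0, by omega⟩ i * y0 i k| ≤ (T : ℤ) := by
        intro i _
        rw [abs_mul]
        have hh := yb i k
        rcases hent ⟨0, by omega⟩ i with h | h | h <;> rw [h] <;> simp <;> omega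
      refine lt_of_le_of_lt (Finset.sum_le_card_nsmul _ _ _ this) ?_
      simpa using hpM
    have hv : v ≠ 0 := by
      intro h
      obtain ⟨k, hk⟩ := yv
      apply hk
      rw [yb']
      refine cast_inj_of_small (K := K) p _ _ ?_ (by simpa using congrFun h k)
      simpa using hbb k
    have H := hMC z1 v hs0 hz1 hv
    let A : Finset K := (Finset.Icc (-(T:ℤ)) T).image (Int.cast : ℤ → K)
    have hA : A.card ≤ 2 * T + 1 := by
      refine Finset.card_image_le.trans ?_
      simp
      omega
    let φ : (Fin M → Fin d → ℤ) → (Fin (M-2) × Fin d → K) := fun z jk =>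
      (z ⟨jk.1.1+1, by have := jk.1.2; omega⟩ jk.2 : K)
    have hinj : Set.InjOn φ F := by
      intro x hx y hy hxy
      obtain ⟨xb, xnz, xs, xv, xa, xb'⟩ := hmem x hx
      obtain ⟨yb, ynz, ys, yv, ya, yb'⟩ := hmem y hy
      have hmid : ∀ (j : Fin (M-2)) k, x ⟨j.1+1, by have := j.2; omega⟩ k = y ⟨j.1+1, by have := j.2; omega⟩ k := by
        intro j k
        refine cast_inj_of_small (K := K) p _ _ ?_ (congrFun hxy (j, k))
        have a1 := xb ⟨j.1+1, by have := j.2; omega⟩ k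
        have a2 := yb ⟨j.1+1, by have := j.2; omega⟩ k
        have := abs_sub (x ⟨j.1+1, by have := j.2; omega⟩ k) (y ⟨j.1+1, by have := j.2; omega⟩ k)
        omega
      have hlast : ∀ k, x ⟨M-1, by omega⟩ k = y ⟨M-1, by omega⟩ k := by
        intro k
        have e := (xb' k).trans (yb' k).symm
        rw [sum_split3 M hM, sum_split3 M hM, h0, h1] at e
        simp only [hmid] at e
        omega
      funext j k
      by_cases hj0 : j.1 = 0
      · have : j = ⟨0, by omega⟩ := Fin.ext hj0
        rw [this, xa, ya]
      · by_cases hj1 : j.1 = M - 1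
        · have : j = ⟨M-1, by omega⟩ := Fin.ext hj1
          rw [this, hlast]
        · have h3 := hmid ⟨j.1 - 1, by omega⟩ k
          have : j = ⟨j.1 - 1 + 1, by omega⟩ := Fin.ext (by simp; omega)
          rw [this]
          exact h3
    rw [← Finset.card_image_of_injOn hinj]
    have hle : (M-2)*(d-1) ≤ Fintype.card (Fin (M-2) × Fin d) := by
      simp
      exact Nat.mul_le_mul_left _ (by omega)
    have PB := point_bound (qPolyInt M d K β z1 v) (qPoly_deg M d K β z1 v) ((M-2)*(d-1)) hle
      H.le A (2*T) hA (F.image φ) ?_ ?_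
    · simpa using PB
    · intro y hy i
      obtain ⟨z, hz, rfl⟩ := Finset.mem_image.1 hy
      obtain ⟨xb, -⟩ := hmem z hz
      refine Finset.mem_image.2 ⟨_, Finset.mem_Icc.2 (abs_le.1 (xb _ _)), rfl⟩
    · intro y hy j
      obtain ⟨z, hz, rfl⟩ := Finset.mem_image.1 hy
      obtain ⟨xb, xnz, xs, xv, xa, xb'⟩ := hmem z hz
      have E := qPoly_eval M d hM K β h0 h1 z z1 v (fun k => by rw [xa]) (fun k => by rw [xb']) j
      rw [xs, Int.cast_zero] at E
      exact E

def HypMC (d N : ℕ) : Prop :=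
  ∀ (p : ℕ) [Fact p.Prime], ∀ (M : ℕ) (_h2 : 1 < M) (_hMN : M ≤ N)
        (β : Matrix (Fin M) (Fin M) ℤ),
        (∀ i j, β j i = -β i j) →
        (∀ i j, β i j = -1 ∨ β i j = 0 ∨ β i j = 1) →
        (∀ i, ∃ j, β i j ≠ 0) →
        β ⟨0, by omega⟩ ⟨M - 1, by omega⟩ = 1 →
        MatIrreducible β →
        MainConj M d (AlgebraicClosure (ZMod p)) β

def cfib (M d : ℕ) : ℕ := 3 ^ (((M-2)*d) * ((M-2)*d)) * (2 * ((M-2)*d) + 1) ^ ((M-2)*(d-1)) *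
  (1485 * 9^(d-3) * M^(2*(d-1)))

theorem cfib_bound (M d T : ℕ) (hM : 2 ≤ M) (hT : 1 ≤ T) :
    (3 ^ (((M-2)*d) * ((M-2)*d)) * (((M-2)*d) * (2*T) + 1) ^ ((M-2)*(d-1))) *
        (1485 * 9^(d-3) * (M*T)^(2*(d-1))) ≤ cfib M d * T ^ (M*(d-1)) := by
  have h1 : ((M-2)*d) * (2*T) + 1 ≤ (2 * ((M-2)*d) + 1) * T := by nlinarith
  have h2 : T ^ (M * (d-1)) = T ^ ((M-2)*(d-1)) * T ^ (2*(d-1)) := by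
    rw [← pow_add, ← Nat.add_mul, Nat.sub_add_cancel hM]
  calc _ ≤ (3 ^ (((M-2)*d) * ((M-2)*d)) * ((2 * ((M-2)*d) + 1) * T) ^ ((M-2)*(d-1))) *
        (1485 * 9^(d-3) * (M*T)^(2*(d-1))) := by gcongr
    _ = _ := by
      rw [h2, cfib, mul_pow, mul_pow]
      ring

open Classical in
theorem zero_bound (ι : Type) [Fintype ι] (α : Matrix ι ι ℤ) (d T : ℕ) (a b : ι)
    (haa : α a a = 0) (hbb : α b b = 0) (hab : α a b ≠ 0) (hba : α b a ≠ 0) :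
    ((solS ι α d T).filter (fun z => ∀ j k, ∑ i, α j i * z i k = 0)).card ≤
      (2 * T + 1) ^ ((Fintype.card ι - 2) * d) := by
  have hne : a ≠ b := by rintro rfl; exact hab haa
  have hcard : Fintype.card {i // i ≠ a ∧ i ≠ b} = Fintype.card ι - 2 := by
    rw [Fintype.card_subtype]
    have : Finset.univ.filter (fun i => i ≠ a ∧ i ≠ b) = (Finset.univ.erase a).erase b := by
      ext i; simp [and_comm]
    rw [this, Finset.card_erase_of_mem (by simp [hne.symm]), Finset.card_erase_of_mem (by simp),
      Finset.card_univ]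
    omega
  have : (Fintype.piFinset (fun _ : {i // i ≠ a ∧ i ≠ b} => zbox d T)).card =
      (2 * T + 1) ^ ((Fintype.card ι - 2) * d) := by
    rw [Fintype.card_piFinset]
    simp only [card_zbox, Finset.prod_const, Finset.card_univ, hcard]
    rw [← pow_mul, mul_comm d]
  rw [← this]
  refine Finset.card_le_card_of_injOn (fun z i => z i.1) ?_ ?_
  · intro z hz
    rw [Finset.mem_coe, Finset.mem_filter, mem_solS] at hz
    rw [Finset.mem_coe, Fintype.mem_piFinset]
    intro i
    rw [mem_zbox]
    exact hz.1.1 i.1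
  · intro x hx y hy hxy
    rw [Finset.mem_coe, Finset.mem_filter] at hx hy
    have hoth : ∀ i, i ≠ a → i ≠ b → ∀ k, x i k = y i k := by
      intro i h1 h2 k
      exact congrFun (congrFun hxy ⟨i, h1, h2⟩) k
    have hA : ∀ k, x a k = y a k := by
      intro k
      have e : ∑ i, α b i * (x i k - y i k) = 0 := by
        simp only [mul_sub, Finset.sum_sub_distrib, hx.2, hy.2, sub_self]
      rw [Finset.sum_eq_single a] at e
      · rcases mul_eq_zero.1 e with h | h
        · exact absurd h hba
        · omega
      · intro i _ hi
        by_cases hib : i = b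
        · rw [hib, hbb, zero_mul]
        · rw [hoth i hi hib, sub_self, mul_zero]
      · simp
    have hB : ∀ k, x b k = y b k := by
      intro k
      have e : ∑ i, α a i * (x i k - y i k) = 0 := by
        simp only [mul_sub, Finset.sum_sub_distrib, hx.2, hy.2, sub_self]
      rw [Finset.sum_eq_single b] at e
      · rcases mul_eq_zero.1 e with h | h
        · exact absurd h hab
        · omega
      · intro i _ hi
        by_cases hib : i = a
        · rw [hib, haa, zero_mul]
        · rw [hoth i hib hi, sub_self, mul_zero]
      · simp
    funext i k
    by_cases h1 : i = a
    · rw [h1, hA]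
    by_cases h2 : i = b
    · rw [h2, hB]
    exact hoth i h1 h2 k

theorem exists_equiv_ends (ι : Type) [Fintype ι] (M : ℕ) (hM : 2 ≤ M) (hc : Fintype.card ι = M)
    (a b : ι) (hab : a ≠ b) :
    ∃ e : ι ≃ Fin M, e a = ⟨0, by omega⟩ ∧ e b = ⟨M-1, by omega⟩ := by
  classical
  let e0 : ι ≃ Fin M := Fintype.equivFinOfCardEq hc
  let e1 := e0.trans (Equiv.swap (e0 a) ⟨0, by omega⟩)
  have h1 : e1 a = ⟨0, by omega⟩ := by simp [e1]
  have h2 : e1 b ≠ ⟨0, by omega⟩ := by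
    rw [← h1]; exact fun h => hab (e1.injective h).symm
  refine ⟨e1.trans (Equiv.swap (e1 b) ⟨M-1, by omega⟩), ?_, by simp⟩
  rw [Equiv.trans_apply, h1]
  apply Equiv.swap_apply_of_ne_of_ne h2.symm
  intro h
  have := congrArg Fin.val h
  simp at this
  omega

def IrrG {ι : Type} (α : Matrix ι ι ℤ) : Prop :=
  ∀ I : Set ι, I.Nonempty → Iᶜ.Nonempty → ∃ i ∈ I, ∃ j ∈ Iᶜ, α i j ≠ 0

open Classical in
theorem row_bound (d N : ℕ) (hd : 3 ≤ d) (hMC : HypMC d N) (ι : Type) [Fintype ι]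
    (hι : Fintype.card ι ≤ N) (α : Matrix ι ι ℤ)
    (hsk : ∀ i j, α j i = -α i j)
    (hent : ∀ i j, α i j = -1 ∨ α i j = 0 ∨ α i j = 1)
    (hrow : ∀ i, ∃ j, α i j ≠ 0) (hirr : IrrG α) (T : ℕ) (hT : 1 ≤ T) (a : ι) :
    ((solS ι α d T).filter (fun z => ∃ k, ∑ i, α a i * z i k ≠ 0)).card ≤
      cfib (Fintype.card ι) d * T ^ (Fintype.card ι * (d-1)) := by
  obtain ⟨b, hab⟩ := hrow a
  have haa : α a a = 0 := by have := hsk a a; omega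
  have hne : a ≠ b := by rintro rfl; exact hab haa
  have hM : 2 ≤ Fintype.card ι := Fintype.one_lt_card_iff.2 ⟨a, b, hne⟩
  generalize hMc : Fintype.card ι = M at *
  obtain ⟨e, ea, eb⟩ := exists_equiv_ends ι M hM hMc a b hne
  set s := α a b with hs
  have hs2 : s * s = 1 := by
    rcases hent a b with h | h | h
    · rw [hs, h]; norm_num
    · exact absurd h hab
    · rw [hs, h]; norm_num
  have hs1 : s = 1 ∨ s = -1 := by
    rcases hent a b with h | h | h
    · right; exact h
    · exact absurd h hab
    · left; exact h
  let β : Matrix (Fin M) (Fin M) ℤ := fun i j => s * α (e.symm i) (e.symm j)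
  have hβ : ∀ i j, β i j = s * α (e.symm i) (e.symm j) := fun i j => rfl
  have hsum : ∀ (z : ι → Fin d → ℤ) (j : ι) k, ∑ i, β (e j) i * z (e.symm i) k = s * ∑ i, α j i * z i k := by
    intro z j k
    rw [← e.sum_comp, Finset.mul_sum]
    refine Finset.sum_congr rfl fun i _ => ?_
    rw [hβ]; simp [mul_assoc]
  obtain ⟨p, hp1, hp⟩ := Nat.exists_infinite_primes (2 * M * T + 1)
  have : Fact p.Prime := ⟨hp⟩
  have b1 : β ⟨0, by omega⟩ ⟨M-1, by omega⟩ = 1 := by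
    rw [hβ, ← ea, ← eb]; simp [← hs, hs2]
  have bsk : ∀ i j, β j i = -β i j := by
    intro i j
    rw [hβ, hβ, hsk (e.symm i) (e.symm j)]; ring
  have bent : ∀ i j, β i j = -1 ∨ β i j = 0 ∨ β i j = 1 := by
    intro i j
    rw [hβ]
    rcases hs1 with h | h <;> rw [h] <;>
    rcases hent (e.symm i) (e.symm j) with h | h | h <;> rw [h] <;> simp
  have hs0 : s ≠ 0 := hab
  have MCβ := hMC p M hM hι β bsk bent ?_ b1 ?_
  · have : CharP (AlgebraicClosure (ZMod p)) p := inferInstance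
    refine le_trans ?_ ((fiber_bound M d T p hM hd hT (AlgebraicClosure (ZMod p)) (by omega) β bsk bent b1 MCβ).trans
      (cfib_bound M d T hM hT))
    refine Finset.card_le_card_of_injOn (fun z i => z (e.symm i)) ?_ ?_
    · intro z hz
      rw [Finset.mem_coe, Finset.mem_filter, mem_solS] at hz
      rw [Finset.mem_coe, Finset.mem_filter, mem_solS]
      refine ⟨⟨fun j k => hz.1.1 _ _, fun j => hz.1.2.1 _, fun j => ?_⟩, ?_⟩
      · have h1 := hz.1.2.2 (e.symm j)
        have h2 := hsum z (e.symm j)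
        rw [Equiv.apply_symm_apply] at h2
        simp only [h2]
        rw [← mul_zero s, ← h1, Finset.mul_sum]
        refine Finset.sum_congr rfl fun k _ => ?_
        ring
      · obtain ⟨k, hk⟩ := hz.2
        refine ⟨k, ?_⟩
        rw [← ea, hsum]
        exact mul_ne_zero hs0 hk
    · intro x _ y _ hxy
      funext i
      have := congrFun hxy (e i)
      simpa using this
  · intro i
    obtain ⟨j, hj⟩ := hrow (e.symm i)
    refine ⟨e j, ?_⟩
    rw [hβ]
    simpa using ⟨hs0, hj⟩
  · intro I ⟨x, hx⟩ ⟨y, hy⟩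
    obtain ⟨i, hi, j, hj, hij⟩ := hirr (e ⁻¹' I) ⟨e.symm x, by simpa using hx⟩ ⟨e.symm y, by simpa using hy⟩
    refine ⟨e i, hi, e j, hj, ?_⟩
    rw [hβ]
    simpa using ⟨hs0, hij⟩

def cirr (N d : ℕ) : ℕ := ∑ M ∈ Finset.range (N+1), (M * cfib M d + 3 ^ ((M-2)*d)) + 1

theorem irr_bound (d N : ℕ) (hd : 3 ≤ d) (hMC : HypMC d N) (ι : Type) [Fintype ι] [Nonempty ι]
    (hι : Fintype.card ι ≤ N) (α : Matrix ι ι ℤ)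
    (hsk : ∀ i j, α j i = -α i j)
    (hent : ∀ i j, α i j = -1 ∨ α i j = 0 ∨ α i j = 1)
    (hrow : ∀ i, ∃ j, α i j ≠ 0) (hirr : IrrG α) (T : ℕ) (hT : 1 ≤ T) :
    (solS ι α d T).card ≤ cirr N d * T ^ (Fintype.card ι * (d-1)) := by
  classical
  have hN : N ≤ d + 2 := N_bound d N hd hMC
  obtain ⟨a⟩ := ‹Nonempty ι›
  obtain ⟨b, hab⟩ := hrow a
  have haa : α a a = 0 := by have := hsk a a; omega
  have hbb : α b b = 0 := by have := hsk b b; omega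
  have hba : α b a ≠ 0 := by have := hsk a b; omega
  have hne : a ≠ b := by rintro rfl; exact hab haa
  have hM : 2 ≤ Fintype.card ι := Fintype.one_lt_card_iff.2 ⟨a, b, hne⟩
  have hsub : solS ι α d T ⊆ (Finset.univ.biUnion fun a => (solS ι α d T).filter (fun z => ∃ k, ∑ i, α a i * z i k ≠ 0)) ∪
      (solS ι α d T).filter (fun z => ∀ j k, ∑ i, α j i * z i k = 0) := by
    intro z hz
    rw [Finset.mem_union, Finset.mem_biUnion]
    by_cases h : ∀ j k, ∑ i, α j i * z i k = 0
    · exact Or.inr (Finset.mem_filter.2 ⟨hz, h⟩)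
    · left
      push Not at h
      obtain ⟨j, k, hjk⟩ := h
      exact ⟨j, Finset.mem_univ _, Finset.mem_filter.2 ⟨hz, k, hjk⟩⟩
  have h1 : (Finset.univ.biUnion fun a => (solS ι α d T).filter (fun z => ∃ k, ∑ i, α a i * z i k ≠ 0)).card
      ≤ Fintype.card ι * (cfib (Fintype.card ι) d * T ^ (Fintype.card ι * (d-1))) :=
    Finset.card_biUnion_le_card_mul _ _ _ fun a _ =>
      row_bound d N hd hMC ι hι α hsk hent hrow hirr T hT a
  have h2 := zero_bound ι α d T a b haa hbb hab hba
  have h3 : (2 * T + 1) ^ ((Fintype.card ι - 2) * d) ≤ 3 ^ ((Fintype.card ι - 2) * d) * T ^ (Fintype.card ι * (d-1)) := by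
    calc (2 * T + 1) ^ ((Fintype.card ι - 2) * d) ≤ (3 * T) ^ ((Fintype.card ι - 2) * d) :=
          Nat.pow_le_pow_left (by omega) _
      _ = 3 ^ ((Fintype.card ι - 2) * d) * T ^ ((Fintype.card ι - 2) * d) := mul_pow _ _ _
      _ ≤ _ := by
        refine Nat.mul_le_mul_left _ (Nat.pow_le_pow_right hT ?_)
        obtain ⟨m, hm⟩ := Nat.exists_eq_add_of_le' hM
        obtain ⟨c, hc⟩ := Nat.exists_eq_add_of_le' hd
        have : m ≤ c + 3 := by omega
        rw [hm, hc]
        simp only [Nat.add_sub_cancel, show c + 3 - 1 = c + 2 by omega]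
        nlinarith
  have h4 : Fintype.card ι * cfib (Fintype.card ι) d + 3 ^ ((Fintype.card ι - 2) * d) ≤ cirr N d := by
    have := Finset.single_le_sum (f := fun M => M * cfib M d + 3 ^ ((M-2)*d)) (fun _ _ => Nat.zero_le _)
      (Finset.mem_range.2 (Nat.lt_succ_of_le hι))
    exact this.trans (Nat.le_succ _)
  calc _ ≤ _ := Finset.card_le_card hsub
    _ ≤ _ := Finset.card_union_le _ _
    _ ≤ Fintype.card ι * (cfib (Fintype.card ι) d * T ^ (Fintype.card ι * (d-1))) +
        3 ^ ((Fintype.card ι - 2) * d) * T ^ (Fintype.card ι * (d-1)) := add_le_add h1 (h2.trans h3)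
    _ = (Fintype.card ι * cfib (Fintype.card ι) d + 3 ^ ((Fintype.card ι - 2) * d)) * T ^ (Fintype.card ι * (d-1)) := by ring
    _ ≤ _ := Nat.mul_le_mul_right _ h4

theorem gen_bound (d N : ℕ) (hd : 3 ≤ d) (hMC : HypMC d N) (T : ℕ) (hT : 1 ≤ T) (n : ℕ) :
    ∀ (ι : Type) [Fintype ι], Fintype.card ι = n →
    Fintype.card ι ≤ N → ∀ (α : Matrix ι ι ℤ),
    (∀ i j, α j i = -α i j) →
    (∀ i j, α i j = -1 ∨ α i j = 0 ∨ α i j = 1) →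
    (∀ i, ∃ j, α i j ≠ 0) →
    (solS ι α d T).card ≤ cirr N d ^ n * T ^ (n * (d-1)) := by
  classical
  induction n using Nat.strong_induction_on with
  | _ n ih =>
  intro ι _ hn hι α hsk hent hrow
  have hc1 : 1 ≤ cirr N d := Nat.le_add_left 1 _
  rcases isEmpty_or_nonempty ι with hE | hne
  · have h0 : n = 0 := by rw [← hn]; exact Fintype.card_eq_zero
    rw [h0]
    simp only [pow_zero, zero_mul, mul_one]
    exact Finset.card_le_one_of_subsingleton _
  · have hnpos : n ≠ 0 := by rw [← hn]; exact Fintype.card_ne_zero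
    by_cases hirr : IrrG α
    · refine (irr_bound d N hd hMC ι hι α hsk hent hrow hirr T hT).trans ?_
      rw [hn]
      exact Nat.mul_le_mul_right _ (Nat.le_self_pow hnpos _)
    · unfold IrrG at hirr
      push Not at hirr
      obtain ⟨I, hI, hJ, hz⟩ := hirr
      have hz' : ∀ i ∈ I, ∀ j, j ∉ I → α i j = 0 := fun i hi j hj => hz i hi j hj
      have hz2 : ∀ i, i ∉ I → ∀ j ∈ I, α i j = 0 := by
        intro i hi j hj
        rw [hsk j i, hz' j hj i hi, neg_zero]
      have hcard : Fintype.card {i // i ∈ I} + Fintype.card {i // i ∉ I} = n := by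
        rw [← hn]
        have h8 := Fintype.sum_subtype_add_sum_subtype (fun i => i ∈ I) (fun _ : ι => (1 : ℕ))
        simp only [Finset.sum_const, Finset.card_univ, smul_eq_mul, mul_one] at h8
        exact h8
      have p1 : 0 < Fintype.card {i // i ∈ I} := Fintype.card_pos_iff.2 ⟨⟨_, hI.some_mem⟩⟩
      have p2 : 0 < Fintype.card {i // i ∉ I} := Fintype.card_pos_iff.2 ⟨⟨_, hJ.some_mem⟩⟩
      have b1 := ih (Fintype.card {i // i ∈ I}) (by omega) {i // i ∈ I} rfl (by omega)
        (α.submatrix (fun i => i.1) (fun i => i.1)) (fun i j => hsk _ _) (fun i j => hent _ _) (by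
          intro i
          obtain ⟨j, hj⟩ := hrow i.1
          have : j ∈ I := by by_contra h; exact hj (hz' _ i.2 _ h)
          exact ⟨⟨j, this⟩, hj⟩)
      have b2 := ih (Fintype.card {i // i ∉ I}) (by omega) {i // i ∉ I} rfl (by omega)
        (α.submatrix (fun i => i.1) (fun i => i.1)) (fun i j => hsk _ _) (fun i j => hent _ _) (by
          intro i
          obtain ⟨j, hj⟩ := hrow i.1
          have : j ∉ I := by intro h; exact hj (hz2 _ i.2 _ h)
          exact ⟨⟨j, this⟩, hj⟩)
      have hsplit : ∀ f : ι → ℤ, ∑ i, f i = ∑ i : {i // i ∈ I}, f i.1 + ∑ i : {i // i ∉ I}, f i.1 := by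
        intro f
        exact (Fintype.sum_subtype_add_sum_subtype (fun i => i ∈ I) f).symm
      have hemb : (solS ι α d T).card ≤
          (solS {i // i ∈ I} (α.submatrix (fun i => i.1) (fun i => i.1)) d T ×ˢ
           solS {i // i ∉ I} (α.submatrix (fun i => i.1) (fun i => i.1)) d T).card := by
        refine Finset.card_le_card_of_injOn (fun z => (fun i => z i.1, fun i => z i.1)) ?_ ?_
        · intro z hzz
          rw [Finset.mem_coe, mem_solS] at hzz
          obtain ⟨c1, c2, c3⟩ := hzz
          rw [Finset.mem_coe, Finset.mem_product, mem_solS, mem_solS]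
          refine ⟨⟨fun j k => c1 _ _, fun j => c2 _, fun j => ?_⟩,
            ⟨fun j k => c1 _ _, fun j => c2 _, fun j => ?_⟩⟩
          · rw [← c3 j.1]
            refine Finset.sum_congr rfl fun k _ => ?_
            rw [hsplit]
            have : ∑ i : {i // i ∉ I}, α j.1 i.1 * z i.1 k = 0 :=
              Finset.sum_eq_zero fun i _ => by rw [hz' _ j.2 _ i.2, zero_mul]
            rw [this, add_zero]
            rfl
          · rw [← c3 j.1]
            refine Finset.sum_congr rfl fun k _ => ?_
            rw [hsplit]
            have : ∑ i : {i // i ∈ I}, α j.1 i.1 * z i.1 k = 0 :=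
              Finset.sum_eq_zero fun i _ => by rw [hz2 _ j.2 _ i.2, zero_mul]
            rw [this, zero_add]
            rfl
        · intro x _ y _ hxy
          have e1 := congrArg Prod.fst hxy
          have e2 := congrArg Prod.snd hxy
          funext i
          by_cases hi : i ∈ I
          · exact congrFun e1 ⟨i, hi⟩
          · exact congrFun e2 ⟨i, hi⟩
      rw [Finset.card_product] at hemb
      refine hemb.trans ((Nat.mul_le_mul b1 b2).trans ?_)
      rw [← hcard, pow_add, add_mul, pow_add]
      exact le_of_eq (by ring)

/-- assuming the Main Conjecture over every `F̄_p` for every irreducible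
skew-symmetric `{-1,0,1}`-matrix of size at most `N`, there is a constant `C(N,d)` such that
for every skew-symmetric `{-1,0,1}`-matrix `α` of size `N` with no zero row, every `L ≥ 2`,
`R ≥ 1` and every bounded `w` supported in the cube `{|z|_∞ < R}`,
`|Σ_{z ∈ Q ∩ 𝒵_L} w(z)| ≤ C(N,d) R^{⌊N/2⌋N₂(d) + (N-2)(d-1)} L^{N(d-1)} ‖w‖_∞`, the sum
being over the points `z ∈ ℤ_L^{Nd}` with all components `z_j` nonzero satisfying all the
resonance conditions `ω_j(z) = 0`. -/
theorem stmt14 (d N : ℕ) (hd : 3 ≤ d) (hN : 3 ≤ N)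
    (hMC : ∀ (p : ℕ) [Fact p.Prime], ∀ (M : ℕ) (_h2 : 2 ≤ M) (_hMN : M ≤ N)
        (β : Matrix (Fin M) (Fin M) ℤ),
        (∀ i j, β j i = -β i j) →
        (∀ i j, β i j = -1 ∨ β i j = 0 ∨ β i j = 1) →
        (∀ i, ∃ j, β i j ≠ 0) →
        β ⟨0, by omega⟩ ⟨M - 1, by omega⟩ = 1 →
        MatIrreducible β →
        MainConj M d (AlgebraicClosure (ZMod p)) β) :
    ∃ C : ℝ, 0 < C ∧ ∀ α : Matrix (Fin N) (Fin N) ℤ,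
      (∀ i j, α j i = -α i j) →
      (∀ i j, α i j = -1 ∨ α i j = 0 ∨ α i j = 1) →
      (∀ i, ∃ j, α i j ≠ 0) →
      ∀ L : ℝ, 2 ≤ L → ∀ R : ℝ, 1 ≤ R →
        ∀ w : (Fin N → Fin d → ℝ) → ℝ,
          (∀ z, w z ≠ 0 → ∀ j k, |z j k| < R) →
          ∀ B : ℝ, (∀ z, |w z| ≤ B) →
            |∑' z : {z : Fin N → Fin d → ℝ //
                (∀ j : Fin N,
                  ∑ k : Fin d, z j k * ∑ i : Fin N, (α j i : ℝ) * z i k = 0) ∧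
                (∀ j k, ∃ m : ℤ, z j k = (m : ℝ) / L) ∧
                ∀ j, z j ≠ 0}, w z.1| ≤
              C * R ^ (N / 2 * N2 d + (N - 2) * (d - 1)) * L ^ (N * (d - 1)) * B := by
  have hMC' : HypMC d N := hMC
  refine ⟨(cirr N d : ℝ) ^ N, ?_, ?_⟩
  · have : 0 < cirr N d := Nat.lt_of_lt_of_le Nat.zero_lt_one (Nat.le_add_left 1 _)
    positivity
  intro α hsk hent hrow L hL R hR w hw B hB
  have hL0 : 0 < L := by linarith
  have hB0 : 0 ≤ B := (abs_nonneg _).trans (hB 0)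
  set T := ⌊R * L⌋₊ with hTdef
  have hRL : 1 ≤ R * L := by nlinarith
  have hT : 1 ≤ T := Nat.le_floor (by simpa using hRL)
  have hTle : (T : ℝ) ≤ R * L := Nat.floor_le (by linarith)
  set X := {z : Fin N → Fin d → ℝ //
                (∀ j : Fin N,
                  ∑ k : Fin d, z j k * ∑ i : Fin N, (α j i : ℝ) * z i k = 0) ∧
                (∀ j k, ∃ m : ℤ, z j k = (m : ℝ) / L) ∧
                ∀ j, z j ≠ 0} with hX
  have hm : ∀ z : X, ∃ m : Fin N → Fin d → ℤ, ∀ j k, z.1 j k = (m j k : ℝ) / L := by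
    intro z
    choose m hm using z.2.2.1
    exact ⟨m, hm⟩
  choose m hm using hm
  have hinj : Function.Injective m := by
    intro x y hxy
    apply Subtype.ext
    funext j k
    rw [hm, hm, hxy]
  have hmem : ∀ z : X, w z.1 ≠ 0 → m z ∈ solS (Fin N) α d T := by
    intro z hz
    rw [mem_solS]
    refine ⟨fun j k => ?_, fun j h0 => ?_, fun j => ?_⟩
    · have h1 := hw z.1 hz j k
      rw [hm, abs_div, abs_of_pos hL0, div_lt_iff₀ hL0] at h1
      have h2 : (m z j k).natAbs ≤ T := by
        apply Nat.le_floor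
        rw [Nat.cast_natAbs, Int.cast_abs]
        exact h1.le
      rw [Int.abs_eq_natAbs]
      exact_mod_cast h2
    · apply z.2.2.2 j
      funext k
      rw [hm, h0]
      simp
    · have h1 := z.2.1 j
      have h2 : ((∑ k, m z j k * ∑ i, α j i * m z i k : ℤ) : ℝ) =
          L * L * ∑ k : Fin d, z.1 j k * ∑ i : Fin N, (α j i : ℝ) * z.1 i k := by
        push_cast
        rw [Finset.mul_sum]
        refine Finset.sum_congr rfl fun k _ => ?_
        have h3 : ∑ i, (α j i : ℝ) * (m z i k : ℝ) = L * ∑ i, (α j i : ℝ) * z.1 i k := by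
          rw [Finset.mul_sum]
          refine Finset.sum_congr rfl fun i _ => ?_
          rw [hm]
          field_simp
        have h4 : (m z j k : ℝ) = L * z.1 j k := by
          rw [hm]
          field_simp
        rw [h3, h4]
        ring
      rw [h1, mul_zero] at h2
      exact_mod_cast h2
  have hfin : {z : X | w z.1 ≠ 0}.Finite := by
    refine Set.Finite.of_finite_image ((solS (Fin N) α d T).finite_toSet.subset ?_) hinj.injOn
    rintro _ ⟨z, hz, rfl⟩
    exact hmem z hz
  have hcard : hfin.toFinset.card ≤ cirr N d ^ N * T ^ (N * (d-1)) := by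
    refine le_trans (Finset.card_le_card_of_injOn (t := solS (Fin N) α d T) m ?_ hinj.injOn)
      (gen_bound d N hd hMC' T hT N (Fin N) (Fintype.card_fin N) (Fintype.card_fin N).le α hsk hent hrow)
    intro z hz
    exact hmem z (hfin.mem_toFinset.1 hz)
  rw [tsum_eq_sum (s := hfin.toFinset) (fun z hz => by
    by_contra h
    exact hz (hfin.mem_toFinset.2 h))]
  have hsum : |∑ z ∈ hfin.toFinset, w z.1| ≤ (hfin.toFinset.card : ℝ) * B := by
    refine (Finset.abs_sum_le_sum_abs _ _).trans ?_
    refine (Finset.sum_le_card_nsmul _ _ B fun z _ => hB z.1).trans ?_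
    rw [nsmul_eq_mul]
  refine hsum.trans (mul_le_mul_of_nonneg_right ?_ hB0)
  have hexp : N * (d-1) ≤ N / 2 * N2 d + (N - 2) * (d - 1) := by
    have e1 : N * (d-1) = 2 * (d-1) + (N-2) * (d-1) := by
      rw [← Nat.add_mul]; congr 1; omega
    rw [e1]
    have e2 : 1 ≤ N / 2 := by omega
    have e3 : 2 * (d-1) ≤ N2 d := by unfold N2; omega
    have e4 : N2 d ≤ N / 2 * N2 d := Nat.le_mul_of_pos_left _ e2
    omega
  calc (hfin.toFinset.card : ℝ) ≤ ((cirr N d ^ N * T ^ (N * (d-1)) : ℕ) : ℝ) := by exact_mod_cast hcard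
    _ = (cirr N d : ℝ) ^ N * (T : ℝ) ^ (N * (d-1)) := by push_cast; ring
    _ ≤ (cirr N d : ℝ) ^ N * (R * L) ^ (N * (d-1)) := by gcongr
    _ = (cirr N d : ℝ) ^ N * R ^ (N * (d-1)) * L ^ (N * (d-1)) := by rw [mul_pow]; ring
    _ ≤ _ := by gcongr
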